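/- arXiv:2506.09436 — 9 statements merged into one kernel-verified Lean document; each statement's English description precedes it below -/
import Mathlib

section
/- Let N ≥ 1, let ℋ_0, …, ℋ_{2N−1} be finite-dimensional complex Hilbert spaces with Hermitian Hamiltonians H_0, …, H_{2N−1}, and let C be a positive semidefinite matrix on ⊗_{n=0}^{2N−1} ℋ_n satisfying the comb causality conditions. For a density matrix ρ on the joint input ⊗_{m=1}^{N} ℋ_{2m−2}, write C*ρ := Tr_{inputs}[C (ρ^T ⊗ I_{outputs})] for the joint output state on ⊗_{m=1}^{N} ℋ_{2m−1}. Then the following are equivalent: (i) there is a real number E' ≤ E such that for every density matrix ρ and every n ∈ {1,…,N}, Σ_{m=1}^{n} ( Tr[(H_{2m−1} ⊗ I)(C*ρ)] − Tr[(H_{2m−2} ⊗ I) ρ] ) ≤ E'; (ii) max_{n∈{1,…,N}} λ_max(O_n) ≤ E, where O_n := Tr_{1,3,…,2N−1}[(H_{1,3,…,2n−1} ⊗ I) C] − (H_{0,2,…,2n−2})^T ⊗ I. -/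
noncomputable section

open scoped BigOperators ComplexOrder

/-- Entrywise tensor (Kronecker) product of square matrices on a product index type. -/
def tens {α β : Type*} (M : Matrix α α ℂ) (P : Matrix β β ℂ) :
    Matrix (α × β) (α × β) ℂ :=
  Matrix.of fun p q => M p.1 q.1 * P p.2 q.2

/-- Partial trace over the first tensor factor. -/
def ptrFst {α β : Type*} [Fintype α] (M : Matrix (α × β) (α × β) ℂ) : Matrix β β ℂ :=
  Matrix.of fun b b' => ∑ a : α, M (a, b) (a, b')

/-- Partial trace over the second tensor factor. -/
def ptrSnd {α β : Type*} [Fintype β] (M : Matrix (α × β) (α × β) ℂ) : Matrix α α ℂ :=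
  Matrix.of fun a a' => ∑ b : β, M (a, b) (a', b)

/-- The largest eigenvalue of a Hermitian matrix, characterized via the Loewner order:
`lamMax M` is the least real `c` such that `c·I − M` is positive semidefinite. -/
def lamMax {α : Type*} [Fintype α] [DecidableEq α] (M : Matrix α α ℂ) : ℝ :=
  sInf {c : ℝ | ((c : ℂ) • (1 : Matrix α α ℂ) - M).PosSemidef}

/-- `H_m ⊗ I`: a Hamiltonian acting on the `m`-th tensor factor, extended by the identity
to the whole tensor product `⊗_k ℂ^(A k)`. -/
def embedAt {N : ℕ} {A : Fin N → ℕ} (m : Fin N)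
    (M : Matrix (Fin (A m)) (Fin (A m)) ℂ) :
    Matrix (∀ k, Fin (A k)) (∀ k, Fin (A k)) ℂ :=
  Matrix.of fun a b =>
    M (a m) (b m) * ∏ k ∈ Finset.univ.erase m, (if a k = b k then (1 : ℂ) else 0)

/-- `C` is (the Choi operator of) an `N`-step quantum comb whose `m`-th input space is
`ℂ^(A m)` (the space `ℋ_{2m−2}`) and whose `m`-th output space is `ℂ^(B m)` (the space
`ℋ_{2m−1}`): `C` is positive semidefinite and there are Choi operators `Csub n` of the
sub-processes consisting of the first `n` steps, satisfying the recursive causality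
conditions `Tr_{2n−1}[C^(n)] = C^(n−1) ⊗ I_{2n−2}` (with `C^(0) = 1`). -/
def IsComb {N : ℕ} {A B : Fin N → ℕ}
    (C : Matrix ((∀ m, Fin (A m)) × (∀ m, Fin (B m)))
      ((∀ m, Fin (A m)) × (∀ m, Fin (B m))) ℂ) : Prop :=
  C.PosSemidef ∧
  ∃ Csub : (n : ℕ) → (h : n ≤ N) →
      Matrix ((∀ m : Fin n, Fin (A (Fin.castLE h m))) × (∀ m : Fin n, Fin (B (Fin.castLE h m))))
        ((∀ m : Fin n, Fin (A (Fin.castLE h m))) × (∀ m : Fin n, Fin (B (Fin.castLE h m)))) ℂ,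
    Csub N le_rfl = C ∧
    Csub 0 (Nat.zero_le N) = 1 ∧
    ∀ (n : ℕ) (h : n + 1 ≤ N)
      (a a' : ∀ m : Fin (n + 1), Fin (A (Fin.castLE h m)))
      (c c' : ∀ m : Fin n, Fin (B (Fin.castLE (Nat.le_of_succ_le h) m))),
      (∑ g : Fin (B (Fin.castLE h (Fin.last n))),
        Csub (n + 1) h (a, Fin.snoc c g) (a', Fin.snoc c' g)) =
      Csub n (Nat.le_of_succ_le h) (Fin.init a, c) (Fin.init a', c') *
        (if a (Fin.last n) = a' (Fin.last n) then 1 else 0)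

/-- The joint output state `C*ρ := Tr_inputs[C (ρ^T ⊗ I_outputs)]` produced by feeding the
joint input state `ρ` into the comb `C`. -/
def Cstar {N : ℕ} {A B : Fin N → ℕ}
    (C : Matrix ((∀ m, Fin (A m)) × (∀ m, Fin (B m)))
      ((∀ m, Fin (A m)) × (∀ m, Fin (B m))) ℂ)
    (ρ : Matrix (∀ m, Fin (A m)) (∀ m, Fin (A m)) ℂ) :
    Matrix (∀ m, Fin (B m)) (∀ m, Fin (B m)) ℂ :=
  ptrFst (C * tens ρ.transpose 1)

open Matrix in
lemma Matrix.PosSemidef.re_trace_mul_nonneg {α : Type*} [Fintype α] {M P : Matrix α α ℂ}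
    (hM : M.PosSemidef) (hP : P.PosSemidef) : 0 ≤ (M * P).trace.re := by
  classical
  obtain ⟨Q, rfl⟩ : ∃ Q : Matrix α α ℂ, P = Q * Qᴴ := by
    open scoped MatrixOrder Norms.L2Operator in
    obtain ⟨Q, hQ⟩ := CStarAlgebra.nonneg_iff_eq_mul_star_self.mp hP.nonneg
    exact ⟨Q, hQ⟩
  rw [← Matrix.mul_assoc, Matrix.trace_mul_cycle]
  exact (Complex.nonneg_iff.mp (hM.conjTranspose_mul_mul_same Q).trace_nonneg).1

lemma Matrix.IsHermitian.exists_posSemidef_smul_one_sub {α : Type*} [Fintype α] [DecidableEq α]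
    {M : Matrix α α ℂ} (hM : M.IsHermitian) :
    ∃ c : ℝ, ((c : ℂ) • (1 : Matrix α α ℂ) - M).PosSemidef := by
  open scoped MatrixOrder Matrix.Norms.L2Operator in
  have h : M ≤ algebraMap ℝ (Matrix α α ℂ) ‖M‖ := IsSelfAdjoint.le_algebraMap_norm_self hM
  refine ⟨‖M‖, ?_⟩
  rw [Matrix.le_iff, Algebra.algebraMap_eq_smul_one] at h
  simpa only [Complex.coe_smul] using h

lemma posSemidef_smul_one_sub_iff_re_trace_le {α : Type*} [Fintype α] [DecidableEq α]
    {M : Matrix α α ℂ} (hM : M.IsHermitian) (c : ℝ) :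
    ((c : ℂ) • (1 : Matrix α α ℂ) - M).PosSemidef ↔
      ∀ σ : Matrix α α ℂ, σ.PosSemidef → σ.trace = 1 → (M * σ).trace.re ≤ c := by
  have hH : ((c : ℂ) • (1 : Matrix α α ℂ) - M).IsHermitian := by
    refine Matrix.IsHermitian.sub ?_ hM
    simp [Matrix.IsHermitian, Matrix.conjTranspose_smul]
  constructor
  · intro h σ hσ ht
    have := h.re_trace_mul_nonneg hσ
    simpa [sub_mul, ht] using this
  · intro h
    refine .of_dotProduct_mulVec_nonneg hH fun x => ?_
    have him : (star x ⬝ᵥ ((c : ℂ) • (1 : Matrix α α ℂ) - M).mulVec x).im = 0 :=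
      hH.im_star_dotProduct_mulVec_self x
    refine Complex.nonneg_iff.mpr ⟨?_, him.symm⟩
    by_cases hx : x = 0
    · simp [hx]
    obtain ⟨hpos, him0⟩ := Complex.pos_iff.mp (Matrix.dotProduct_self_star_pos_iff.mpr hx)
    set t := (x ⬝ᵥ star x).re
    have ht : x ⬝ᵥ star x = (t : ℂ) := Complex.ext rfl him0.symm
    have hσ := h (((t⁻¹ : ℝ) : ℂ) • Matrix.vecMulVec x (star x))
      ((Matrix.posSemidef_vecMulVec_self_star x).smul (by
        exact_mod_cast (inv_pos.mpr hpos).le))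
      (by
        rw [Matrix.trace_smul, Matrix.trace_vecMulVec, ht, smul_eq_mul, ← Complex.ofReal_mul,
          inv_mul_cancel₀ hpos.ne', Complex.ofReal_one])
    rw [Matrix.mul_smul, Matrix.trace_smul, Matrix.mul_vecMulVec, Matrix.trace_vecMulVec,
      smul_eq_mul, Complex.re_ofReal_mul, inv_mul_le_iff₀ hpos] at hσ
    rw [Matrix.sub_mulVec, dotProduct_sub, Matrix.smul_mulVec, Matrix.one_mulVec,
      dotProduct_smul, dotProduct_comm (star x) x, ht, dotProduct_comm (star x)]
    simp only [Complex.sub_re, smul_eq_mul, ← Complex.ofReal_mul, Complex.ofReal_re]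
    linarith

lemma lamMax_le_iff {α : Type*} [Fintype α] [DecidableEq α] [Nonempty α]
    {M : Matrix α α ℂ} (hM : M.IsHermitian) (c : ℝ) :
    lamMax M ≤ c ↔
      ∀ σ : Matrix α α ℂ, σ.PosSemidef → σ.trace = 1 → (M * σ).trace.re ≤ c := by
  constructor
  · intro h σ hσ ht
    exact (le_csInf hM.exists_posSemidef_smul_one_sub fun d hd =>
      (posSemidef_smul_one_sub_iff_re_trace_le hM d).mp hd σ hσ ht).trans h
  · intro h
    refine csInf_le ?_ ((posSemidef_smul_one_sub_iff_re_trace_le hM c).mpr h)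
    obtain ⟨i⟩ := ‹Nonempty α›
    refine ⟨(M i i).re, fun d hd => ?_⟩
    simpa using (Complex.nonneg_iff.mp (hd.diag_nonneg (i := i))).1

lemma trace_mul_ptrFst_mul_tens_one {α β : Type*} [Fintype α] [Fintype β] [DecidableEq α]
    [DecidableEq β] (P : Matrix β β ℂ) (C : Matrix (α × β) (α × β) ℂ) (R : Matrix α α ℂ) :
    (P * ptrFst (C * tens R 1)).trace = (ptrSnd (tens 1 P * C) * R).trace := by
  simp only [Matrix.trace, Matrix.diag_apply, Matrix.mul_apply, ptrFst, ptrSnd, tens,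
    Matrix.of_apply, Matrix.one_apply, Fintype.sum_prod_type, mul_ite, ite_mul, mul_one, one_mul,
    mul_zero, zero_mul, Finset.sum_ite_irrel, Finset.sum_const_zero, Finset.sum_ite_eq,
    Finset.sum_ite_eq', Finset.mem_univ, if_true, Finset.mul_sum, Finset.sum_mul]
  simp only [← Fintype.sum_prod_type']
  let e : β × β × α × α ≃ α × α × β × β :=
    ⟨fun p => (p.2.2.1, p.2.2.2, p.1, p.2.1), fun q => (q.2.2.1, q.2.2.2, q.1, q.2.1),
      fun _ => rfl, fun _ => rfl⟩
  exact Fintype.sum_equiv e _ _ fun p => (mul_assoc (P _ _) (C _ _) (R _ _)).symm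

lemma isHermitian_ptrSnd_tens_one_mul {α β : Type*} [Fintype α] [Fintype β] [DecidableEq α]
    {P : Matrix β β ℂ} {C : Matrix (α × β) (α × β) ℂ} (hP : P.IsHermitian) (hC : C.IsHermitian) :
    (ptrSnd (tens 1 P * C)).IsHermitian := by
  ext a a'
  simp only [Matrix.conjTranspose_apply, Matrix.mul_apply, ptrSnd, tens, Matrix.of_apply,
    Matrix.one_apply, Fintype.sum_prod_type, ite_mul, one_mul, zero_mul, Finset.sum_ite_irrel,
    Finset.sum_const_zero, Finset.sum_ite_eq, Finset.mem_univ, if_true, star_sum, star_mul',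
    hP.apply, hC.apply]
  exact Finset.sum_comm

lemma isHermitian_embedAt {N : ℕ} {A : Fin N → ℕ} (m : Fin N)
    {M : Matrix (Fin (A m)) (Fin (A m)) ℂ} (hM : M.IsHermitian) : (embedAt m M).IsHermitian := by
  ext a b
  simp [embedAt, hM.apply, apply_ite, eq_comm]

lemma Matrix.isHermitian_sum {ι α : Type*} (s : Finset ι) {M : ι → Matrix α α ℂ}
    (hM : ∀ i, (M i).IsHermitian) : (∑ i ∈ s, M i).IsHermitian := by
  rw [Matrix.IsHermitian, Matrix.conjTranspose_sum]
  exact Finset.sum_congr rfl fun i _ => hM i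

/-- Theorem 1 of the paper, global-battery case.
An `N`-step quantum comb `C` (with `m`-th input space `ℋ_{2m−2} = ℂ^(A m)` carrying the
Hermitian Hamiltonian `HA m`, and `m`-th output space `ℋ_{2m−1} = ℂ^(B m)` carrying the
Hermitian Hamiltonian `HB m`) admits a global battery of energy `E'` for some `E' ≤ E`
— i.e. for every joint input density matrix `ρ` and every `n`, the total energy increase
over the first `n` steps is at most `E'` — if and only if
`λ_max(O_n) ≤ E` for every `n`, where
`O_n = Tr_outputs[(H_{1,3,…,2n−1} ⊗ I) C] − (H_{0,2,…,2n−2})^T ⊗ I`. -/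
theorem energy_constrained_comb_global
    (N : ℕ) (hN : 1 ≤ N) (A B : Fin N → ℕ)
    (hA : ∀ m, 0 < A m) (hB : ∀ m, 0 < B m)
    (HA : ∀ m, Matrix (Fin (A m)) (Fin (A m)) ℂ)
    (HB : ∀ m, Matrix (Fin (B m)) (Fin (B m)) ℂ)
    (hHA : ∀ m, (HA m).IsHermitian) (hHB : ∀ m, (HB m).IsHermitian)
    (C : Matrix ((∀ m, Fin (A m)) × (∀ m, Fin (B m)))
      ((∀ m, Fin (A m)) × (∀ m, Fin (B m))) ℂ)
    (hC : IsComb C) (E : ℝ) :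
    (∃ E' ≤ E,
      ∀ ρ : Matrix (∀ m, Fin (A m)) (∀ m, Fin (A m)) ℂ,
        ρ.PosSemidef → ρ.trace = 1 →
        ∀ n : Fin N,
          (∑ m ∈ Finset.univ.filter (fun m => m ≤ n),
              ((embedAt m (HB m) * Cstar C ρ).trace.re -
                (embedAt m (HA m) * ρ).trace.re)) ≤ E')
    ↔
    (∀ n : Fin N,
      lamMax
        (ptrSnd
          (tens (1 : Matrix (∀ m, Fin (A m)) (∀ m, Fin (A m)) ℂ)
            (∑ m ∈ Finset.univ.filter (fun m => m ≤ n), embedAt m (HB m)) * C) -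
          (∑ m ∈ Finset.univ.filter (fun m => m ≤ n), embedAt m (HA m)).transpose) ≤ E) := by
  have : Nonempty (∀ m, Fin (A m)) := ⟨fun m => ⟨0, hA m⟩⟩
  have hH (n : Fin N) := (isHermitian_ptrSnd_tens_one_mul
    (Matrix.isHermitian_sum (Finset.univ.filter (fun m => m ≤ n))
      fun m => isHermitian_embedAt m (hHB m)) hC.1.isHermitian).sub
    (Matrix.isHermitian_sum (Finset.univ.filter (fun m => m ≤ n))
      fun m => isHermitian_embedAt m (hHA m)).transpose
  have key (ρ : Matrix (∀ m, Fin (A m)) (∀ m, Fin (A m)) ℂ) (s : Finset (Fin N)) :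
      ∑ m ∈ s, ((embedAt m (HB m) * Cstar C ρ).trace.re - (embedAt m (HA m) * ρ).trace.re) =
        ((ptrSnd (tens (1 : Matrix (∀ m, Fin (A m)) (∀ m, Fin (A m)) ℂ)
          (∑ m ∈ s, embedAt m (HB m)) * C) -
          (∑ m ∈ s, embedAt m (HA m)).transpose) * ρ.transpose).trace.re := by
    rw [sub_mul, Matrix.trace_sub, ← trace_mul_ptrFst_mul_tens_one, ← Matrix.transpose_mul,
      Matrix.trace_transpose, Matrix.trace_mul_comm ρ, Finset.sum_mul, Finset.sum_mul,
      Matrix.trace_sum, Matrix.trace_sum, Complex.sub_re, Complex.re_sum, Complex.re_sum,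
      Finset.sum_sub_distrib]
    rfl
  simp only [key, lamMax_le_iff (hH _)]
  constructor
  · rintro ⟨E', hE', h⟩ n σ hσ ht
    simpa using (h σ.transpose hσ.transpose (by rwa [Matrix.trace_transpose]) n).trans hE'
  · intro h
    exact ⟨E, le_rfl, fun ρ hρ ht n =>
      h n ρ.transpose hρ.transpose (by rwa [Matrix.trace_transpose])⟩
end
end

section
/- Let N ≥ 1 and let ℋ_1, ℋ_3, …, ℋ_{2N−1}, ℋ'_2, ℋ'_4, …, ℋ'_{2N}, ℋ_2, ℋ_4, …, ℋ_{2N} be finite-dimensional Hilbert spaces carrying Hermitian Hamiltonians H_1, …, H_{2N−1}, H'_2, …, H'_{2N}, H_2, …, H_{2N}. Let C_1 be an N-step quantum comb with input spaces ℋ_1, ℋ_3, …, ℋ_{2N−1} and output spaces ℋ'_2, …, ℋ'_{2N}, and let C_2 be an N-step quantum comb with input spaces ℋ'_2, …, ℋ'_{2N} and output spaces ℋ_2, …, ℋ_{2N}. Let C := C_1 * C_2 = Tr_{ℋ'}[ (C_1^{T_{ℋ'}} ⊗ I)(I ⊗ C_2) ] be the concatenation over all primed spaces ℋ' = ℋ'_2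 ⊗ ⋯ ⊗ ℋ'_{2N}. Define the global energy consumption of an N-step comb D with input Hamiltonians K_1,…,K_N and output Hamiltonians M_1,…,M_N by E_gl(D) := max_{1≤n≤N} λ_max( Tr_{outputs}[ ((Σ_{m=1}^{n} M_m) ⊗ I) D ] − (Σ_{m=1}^{n} K_m)^T ⊗ I ). Then E_gl(C_1 * C_2) ≤ E_gl(C_1) + E_gl(C_2). -/
noncomputable section

open scoped BigOperators ComplexOrder

/-- `C₁^{T_{ℋ'}} ⊗ I_B`: the partial transpose of `C₁` over its output (primed) spaces,
tensored with the identity on the final output spaces. -/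
def ptTensId {N : ℕ} {A P B : Fin N → ℕ}
    (C₁ : Matrix ((∀ m, Fin (A m)) × (∀ m, Fin (P m)))
      ((∀ m, Fin (A m)) × (∀ m, Fin (P m))) ℂ) :
    Matrix ((∀ m, Fin (A m)) × (∀ m, Fin (P m)) × (∀ m, Fin (B m)))
      ((∀ m, Fin (A m)) × (∀ m, Fin (P m)) × (∀ m, Fin (B m))) ℂ :=
  Matrix.of fun u v =>
    C₁ (u.1, v.2.1) (v.1, u.2.1) * (if u.2.2 = v.2.2 then 1 else 0)

/-- `I_A ⊗ C₂`: the identity on the global input spaces tensored with `C₂`. -/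
def idTens {N : ℕ} {A P B : Fin N → ℕ}
    (C₂ : Matrix ((∀ m, Fin (P m)) × (∀ m, Fin (B m)))
      ((∀ m, Fin (P m)) × (∀ m, Fin (B m))) ℂ) :
    Matrix ((∀ m, Fin (A m)) × (∀ m, Fin (P m)) × (∀ m, Fin (B m)))
      ((∀ m, Fin (A m)) × (∀ m, Fin (P m)) × (∀ m, Fin (B m))) ℂ :=
  Matrix.of fun u v =>
    (if u.1 = v.1 then 1 else 0) * C₂ (u.2.1, u.2.2) (v.2.1, v.2.2)

/-- The link product `C₁ * C₂ = Tr_{ℋ'}[(C₁^{T_{ℋ'}} ⊗ I)(I ⊗ C₂)]`, concatenating the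
outputs of `C₁` with the inputs of `C₂` over all primed spaces. -/
def linkMat {N : ℕ} {A P B : Fin N → ℕ}
    (C₁ : Matrix ((∀ m, Fin (A m)) × (∀ m, Fin (P m)))
      ((∀ m, Fin (A m)) × (∀ m, Fin (P m))) ℂ)
    (C₂ : Matrix ((∀ m, Fin (P m)) × (∀ m, Fin (B m)))
      ((∀ m, Fin (P m)) × (∀ m, Fin (B m))) ℂ) :
    Matrix ((∀ m, Fin (A m)) × (∀ m, Fin (B m)))
      ((∀ m, Fin (A m)) × (∀ m, Fin (B m))) ℂ :=
  Matrix.of fun x y => ∑ p : ∀ m, Fin (P m),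
    (ptTensId (B := B) C₁ * idTens (A := A) C₂) (x.1, p, x.2) (y.1, p, y.2)

/-- The global-battery energy consumption
`E_gl(D) = max_{1≤n≤N} λ_max(Tr_outputs[((Σ_{m≤n} M_m) ⊗ I) D] − (Σ_{m≤n} K_m)^T ⊗ I)`
of an `N`-step comb `D` whose `m`-th input (resp. output) space carries the Hamiltonian
`HA m` (resp. `HB m`). -/
def Egl {N : ℕ} {A B : Fin N → ℕ}
    (HA : ∀ m, Matrix (Fin (A m)) (Fin (A m)) ℂ)
    (HB : ∀ m, Matrix (Fin (B m)) (Fin (B m)) ℂ)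
    (D : Matrix ((∀ m, Fin (A m)) × (∀ m, Fin (B m)))
      ((∀ m, Fin (A m)) × (∀ m, Fin (B m))) ℂ) : ℝ :=
  ⨆ n : Fin N,
    lamMax
      (ptrSnd
        (tens (1 : Matrix (∀ m, Fin (A m)) (∀ m, Fin (A m)) ℂ)
          (∑ m ∈ Finset.univ.filter (fun m => m ≤ n), embedAt m (HB m)) * D) -
        (∑ m ∈ Finset.univ.filter (fun m => m ≤ n), embedAt m (HA m)).transpose)

namespace Choi

open Matrix

section Finite

variable {α β : Type*} [Fintype β]

/-- The linear map whose Choi operator is `C`. -/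
def toMap (C : Matrix (α × β) (α × β) ℂ) : Matrix β β ℂ →ₗ[ℂ] Matrix α α ℂ where
  toFun X := Matrix.of fun a a' => ∑ p, ∑ q, C (a, q) (a', p) * X q p
  map_add' X Y := by
    ext a a'
    simp [mul_add, Finset.sum_add_distrib]
  map_smul' c X := by
    ext a a'
    simp [Finset.mul_sum, mul_left_comm]

lemma toMap_apply (C : Matrix (α × β) (α × β) ℂ) (X : Matrix β β ℂ) (a a' : α) :
    toMap C X a a' = ∑ p, ∑ q, C (a, q) (a', p) * X q p := rfl

lemma toMap_isHermitian {C : Matrix (α × β) (α × β) ℂ} (hC : C.IsHermitian)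
    {X : Matrix β β ℂ} (hX : X.IsHermitian) : (toMap C X).IsHermitian := by
  ext a a'
  simp only [conjTranspose_apply, toMap_apply, star_sum, star_mul']
  rw [Finset.sum_comm]
  refine Finset.sum_congr rfl fun p _ => Finset.sum_congr rfl fun q _ => ?_
  rw [hC.apply, hX.apply]

lemma toMap_posSemidef [Fintype α] [DecidableEq α] {C : Matrix (α × β) (α × β) ℂ} (hC : C.PosSemidef)
    {X : Matrix β β ℂ} (hX : X.PosSemidef) : (toMap C X).PosSemidef := by
  let V : Matrix (α × β) α ℂ := Matrix.of fun x a => if x.1 = a then 1 else 0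
  have h := (hC.hadamard (hX.submatrix (Prod.snd : α × β → β))).conjTranspose_mul_mul_same V
  have hV : toMap C X = Vᴴ * (C ⊙ X.submatrix Prod.snd Prod.snd) * V := by
    ext a a'
    simp [V, toMap_apply, mul_apply, Fintype.sum_prod_type, hadamard_apply, apply_ite]
  rw [hV]
  exact h

lemma ptrSnd_tens_one_mul [Fintype α] [DecidableEq α] (C : Matrix (α × β) (α × β) ℂ) (M : Matrix β β ℂ) :
    ptrSnd (tens (1 : Matrix α α ℂ) M * C) = toMap C Mᵀ := by
  ext a a'
  simp [ptrSnd, tens, toMap_apply, mul_apply, Fintype.sum_prod_type, one_apply, mul_comm]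

end Finite

section LamMax

variable {α : Type*} [Fintype α] [DecidableEq α]

lemma nonempty_setOf_posSemidef_smul_one_sub {M : Matrix α α ℂ} (hM : M.IsHermitian) :
    {c : ℝ | ((c : ℂ) • (1 : Matrix α α ℂ) - M).PosSemidef}.Nonempty := by
  open scoped MatrixOrder Matrix.Norms.L2Operator in
  obtain ⟨r, hr⟩ : ∃ r : ℝ, M ≤ algebraMap ℝ _ r :=
    ⟨_, IsSelfAdjoint.le_algebraMap_norm_self (a := M) hM⟩
  rw [Matrix.le_iff, Algebra.algebraMap_eq_smul_one] at hr
  exact ⟨r, by simpa only [Set.mem_ofPred_eq, Complex.coe_smul] using hr⟩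

lemma lamMax_le [Nonempty α] {M : Matrix α α ℂ} {c : ℝ}
    (hc : ((c : ℂ) • (1 : Matrix α α ℂ) - M).PosSemidef) : lamMax M ≤ c := by
  refine csInf_le ?_ hc
  obtain ⟨i⟩ := ‹Nonempty α›
  refine ⟨(M i i).re, fun d hd => ?_⟩
  have h := (Complex.le_def.mp (hd.diag_nonneg (i := i))).1
  simp at h
  exact h

lemma lamMax_le_add {β γ : Type*} [Fintype β] [DecidableEq β] [Fintype γ] [DecidableEq γ]
    [Nonempty α] {M : Matrix α α ℂ} {M₁ : Matrix β β ℂ} {M₂ : Matrix γ γ ℂ}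
    (h₁ : M₁.IsHermitian) (h₂ : M₂.IsHermitian)
    (h : ∀ c₁ c₂ : ℝ, ((c₁ : ℂ) • (1 : Matrix β β ℂ) - M₁).PosSemidef →
      ((c₂ : ℂ) • (1 : Matrix γ γ ℂ) - M₂).PosSemidef →
      (((c₁ + c₂ : ℝ) : ℂ) • (1 : Matrix α α ℂ) - M).PosSemidef) :
    lamMax M ≤ lamMax M₁ + lamMax M₂ := by
  rw [← sub_le_iff_le_add]
  refine le_csInf (nonempty_setOf_posSemidef_smul_one_sub h₁) fun c₁ hc₁ => ?_
  rw [sub_le_comm]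
  refine le_csInf (nonempty_setOf_posSemidef_smul_one_sub h₂) fun c₂ hc₂ => ?_
  rw [sub_le_iff_le_add']
  exact lamMax_le (h c₁ c₂ hc₁ hc₂)

end LamMax

section Comb

variable {N : ℕ} {A P B : Fin N → ℕ}

lemma embedAt_isHermitian (m : Fin N) {M : Matrix (Fin (A m)) (Fin (A m)) ℂ}
    (hM : M.IsHermitian) : (embedAt m M).IsHermitian := by
  ext a b
  simp only [conjTranspose_apply, embedAt, of_apply, star_mul', hM.apply, star_prod]
  congr 1
  refine Finset.prod_congr rfl fun k _ => ?_
  simp [apply_ite, eq_comm]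

lemma sum_embedAt_isHermitian (s : Finset (Fin N))
    {H : ∀ m, Matrix (Fin (A m)) (Fin (A m)) ℂ} (hH : ∀ m, (H m).IsHermitian) :
    (∑ m ∈ s, embedAt m (H m)).IsHermitian := by
  rw [IsHermitian, conjTranspose_sum]
  exact Finset.sum_congr rfl fun m _ => embedAt_isHermitian m (hH m)

lemma toMap_linkMat
    (C₁ : Matrix ((∀ m, Fin (A m)) × (∀ m, Fin (P m)))
      ((∀ m, Fin (A m)) × (∀ m, Fin (P m))) ℂ)
    (C₂ : Matrix ((∀ m, Fin (P m)) × (∀ m, Fin (B m)))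
      ((∀ m, Fin (P m)) × (∀ m, Fin (B m))) ℂ)
    (Y : Matrix (∀ m, Fin (B m)) (∀ m, Fin (B m)) ℂ) :
    toMap (linkMat C₁ C₂) Y = toMap C₁ (toMap C₂ Y) := by
  have hlink : ∀ a b a' b', linkMat C₁ C₂ (a, b) (a', b') =
      ∑ p, ∑ q, C₁ (a, q) (a', p) * C₂ (q, b) (p, b') := by
    intro a b a' b'
    simp only [linkMat, ptTensId, idTens, of_apply, mul_apply, Fintype.sum_prod_type, mul_ite,
      ite_mul, mul_one, one_mul, mul_zero, zero_mul]
    simp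
  ext a a'
  simp only [toMap_apply, hlink, Finset.mul_sum, Finset.sum_mul]
  rw [Finset.sum_congr rfl fun _ _ => Finset.sum_comm, Finset.sum_comm]
  refine Finset.sum_congr rfl fun p _ => ?_
  rw [Finset.sum_congr rfl fun _ _ => Finset.sum_comm, Finset.sum_comm]
  simp only [mul_assoc]

lemma toMap_one_of_isComb
    {C : Matrix ((∀ m, Fin (A m)) × (∀ m, Fin (P m)))
      ((∀ m, Fin (A m)) × (∀ m, Fin (P m))) ℂ} (hC : IsComb C) :
    toMap C 1 = 1 := by
  obtain ⟨-, Csub, hN, h0, hstep⟩ := hC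
  have key : ∀ (n : ℕ) (h : n ≤ N) (a a' : ∀ m : Fin n, Fin (A (Fin.castLE h m))),
      ∑ c, Csub n h (a, c) (a', c) = if a = a' then 1 else 0 := by
    intro n
    induction n with
    | zero =>
      intro h a a'
      simp [h0, Subsingleton.elim a a']
    | succ n ih =>
      intro h a a'
      rw [← (Fin.snocEquiv fun m => Fin (P (Fin.castLE h m))).sum_comp, Fintype.sum_prod_type,
        Finset.sum_comm]
      have hs := fun c => hstep n h a a' c c
      simp only [Fin.snocEquiv, Equiv.coe_fn_mk]
      refine (Finset.sum_congr rfl fun c _ => hs c).trans ?_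
      rw [← Finset.sum_mul]
      refine (congrArg (· * _) (ih (Nat.le_of_succ_le h) (Fin.init a) (Fin.init a'))).trans ?_
      have : a = a' ↔ Fin.init a = Fin.init a' ∧ a (Fin.last n) = a' (Fin.last n) := by
        refine ⟨fun h => h ▸ ⟨rfl, rfl⟩, fun ⟨h₁, h₂⟩ => ?_⟩
        rw [← Fin.snoc_init_self a, ← Fin.snoc_init_self a', h₁, h₂]
      rw [if_congr this rfl rfl, ite_and, mul_ite, mul_one, mul_zero]
      split_ifs <;> rfl
  have htr := key N le_rfl
  rw [hN] at htr
  ext a a'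
  simp only [toMap_apply, one_apply, mul_ite, mul_one, mul_zero, Finset.sum_ite_eq',
    Finset.mem_univ, if_true]
  exact htr a a'

end Comb

end Choi

/-- Lemma 3 of the paper, global-battery case.
For `N`-step quantum combs `C₁` (input spaces `ℋ_1,…,ℋ_{2N−1}` with Hermitian Hamiltonians
`HA`, output spaces `ℋ'_2,…,ℋ'_{2N}` with Hermitian Hamiltonians `HP`) and `C₂`
(input spaces `ℋ'_2,…,ℋ'_{2N}`, output spaces `ℋ_2,…,ℋ_{2N}` with Hermitian Hamiltonians
`HB`), the global energy consumption of the concatenation `C₁ * C₂` is subadditive: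
`E_gl(C₁ * C₂) ≤ E_gl(C₁) + E_gl(C₂)`. -/
theorem energy_subadditive_link_global
    (N : ℕ) (hN : 1 ≤ N) (A P B : Fin N → ℕ)
    (hA : ∀ m, 0 < A m) (hP : ∀ m, 0 < P m) (hB : ∀ m, 0 < B m)
    (HA : ∀ m, Matrix (Fin (A m)) (Fin (A m)) ℂ)
    (HP : ∀ m, Matrix (Fin (P m)) (Fin (P m)) ℂ)
    (HB : ∀ m, Matrix (Fin (B m)) (Fin (B m)) ℂ)
    (hHA : ∀ m, (HA m).IsHermitian) (hHP : ∀ m, (HP m).IsHermitian)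
    (hHB : ∀ m, (HB m).IsHermitian)
    (C₁ : Matrix ((∀ m, Fin (A m)) × (∀ m, Fin (P m)))
      ((∀ m, Fin (A m)) × (∀ m, Fin (P m))) ℂ)
    (C₂ : Matrix ((∀ m, Fin (P m)) × (∀ m, Fin (B m)))
      ((∀ m, Fin (P m)) × (∀ m, Fin (B m))) ℂ)
    (hC₁ : IsComb C₁) (hC₂ : IsComb C₂) :
    Egl HA HB (linkMat C₁ C₂) ≤ Egl HA HP C₁ + Egl HP HB C₂ := by
  open Choi in
  have : ∀ m, NeZero (A m) := fun m => ⟨(hA m).ne'⟩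
  have : Nonempty (Fin N) := ⟨⟨0, hN⟩⟩
  refine ciSup_le fun n => ?_
  have hKA := (sum_embedAt_isHermitian (Finset.univ.filter (· ≤ n)) hHA).transpose
  have hKP := (sum_embedAt_isHermitian (Finset.univ.filter (· ≤ n)) hHP).transpose
  have hKB := (sum_embedAt_isHermitian (Finset.univ.filter (· ≤ n)) hHB).transpose
  refine le_trans ?_ (add_le_add (le_ciSup (Set.finite_range _).bddAbove n)
    (le_ciSup (Set.finite_range _).bddAbove n))
  simp only [ptrSnd_tens_one_mul, toMap_linkMat]
  refine lamMax_le_add ((toMap_isHermitian hC₁.1.1 hKP).sub hKA)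
    ((toMap_isHermitian hC₂.1.1 hKB).sub hKP) fun c₁ c₂ h₁ h₂ => ?_
  convert h₁.add (toMap_posSemidef hC₁.1 h₂) using 1
  simp only [map_sub, map_smul, toMap_one_of_isComb hC₁, Complex.ofReal_add, add_smul]
  abel
end
end

section
/- Let N ≥ 1 and let ℋ_1, ℋ_3, …, ℋ_{2N−1}, ℋ'_2, ℋ'_4, …, ℋ'_{2N}, ℋ_2, ℋ_4, …, ℋ_{2N} be finite-dimensional Hilbert spaces carrying Hermitian Hamiltonians. Let C_1 be an N-step quantum comb with input spaces ℋ_1, ℋ_3, …, ℋ_{2N−1} and output spaces ℋ'_2, …, ℋ'_{2N}, let C_2 be an N-step quantum comb with input spaces ℋ'_2, …, ℋ'_{2N} and output spaces ℋ_2, …, ℋ_{2N}, and let C := C_1 * C_2 = Tr_{ℋ'}[ (C_1^{T_{ℋ'}} ⊗ I)(I ⊗ C_2) ] be their concatenation over all primed spaces. Define the local energy consumption of an N-step comb D with input Hamiltonians K_1,…,K_N and output Hamiltonians M_1,…,M_N by E_loc(D) := Σ_{n=1}^{N} max{ λ_max( Tr_{outputs}[ (M_n ⊗ I) D ] − (K_n)^T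 ⊗ I ), 0 }. Then E_loc(C_1 * C_2) ≤ E_loc(C_1) + E_loc(C_2). -/
noncomputable section

open scoped BigOperators ComplexOrder

/-- The local-battery energy consumption
`E_loc(D) = Σ_{n=1}^{N} max{λ_max(Tr_outputs[(M_n ⊗ I) D] − (K_n)^T ⊗ I), 0}`
of an `N`-step comb `D` whose `m`-th input (resp. output) space carries the Hamiltonian
`HA m` (resp. `HB m`). -/
def Eloc {N : ℕ} {A B : Fin N → ℕ}
    (HA : ∀ m, Matrix (Fin (A m)) (Fin (A m)) ℂ)
    (HB : ∀ m, Matrix (Fin (B m)) (Fin (B m)) ℂ)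
    (D : Matrix ((∀ m, Fin (A m)) × (∀ m, Fin (B m)))
      ((∀ m, Fin (A m)) × (∀ m, Fin (B m))) ℂ) : ℝ :=
  ∑ n : Fin N,
    max (lamMax
      (ptrSnd
        (tens (1 : Matrix (∀ m, Fin (A m)) (∀ m, Fin (A m)) ℂ)
          (embedAt n (HB n)) * D) -
        (embedAt n (HA n)).transpose)) 0

/-- The action `X ↦ Tr₂[(I ⊗ Xᵀ) D]` of a Choi operator `D` on observables of its output space. -/
def choiAct {α β : Type*} [Fintype β] (D : Matrix (α × β) (α × β) ℂ) (X : Matrix β β ℂ) :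
    Matrix α α ℂ :=
  Matrix.of fun a a' => ∑ q, ∑ p, D (a, q) (a', p) * X q p

section choiAct

variable {α β : Type*} [Fintype β] (D : Matrix (α × β) (α × β) ℂ)

lemma choiAct_add (X Y : Matrix β β ℂ) :
    choiAct D (X + Y) = choiAct D X + choiAct D Y := by
  ext a a'
  simp [choiAct, mul_add, Finset.sum_add_distrib]

lemma choiAct_sub (X Y : Matrix β β ℂ) :
    choiAct D (X - Y) = choiAct D X - choiAct D Y := by
  ext a a'
  simp [choiAct, mul_sub, Finset.sum_sub_distrib]

lemma choiAct_smul (c : ℂ) (X : Matrix β β ℂ) : choiAct D (c • X) = c • choiAct D X := by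
  ext a a'
  simp [choiAct, Finset.mul_sum, mul_left_comm]

lemma choiAct_one [DecidableEq β] : choiAct D 1 = ptrSnd D := by
  ext a a'
  simp [choiAct, ptrSnd, Matrix.one_apply]

lemma ptrSnd_tens_one_mul [Fintype α] [DecidableEq α] (M : Matrix β β ℂ) :
    ptrSnd (tens 1 M * D) = choiAct D M.transpose := by
  ext a a'
  simp only [ptrSnd, tens, choiAct, Matrix.of_apply, Matrix.mul_apply, Fintype.sum_prod_type,
    Matrix.one_apply, ite_mul, one_mul, zero_mul, Matrix.transpose_apply]
  rw [Finset.sum_comm]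
  simp only [Finset.sum_ite_irrel, Finset.sum_const_zero, Finset.sum_ite_eq, Finset.mem_univ, if_true]
  rw [Finset.sum_comm]
  simp [mul_comm]

variable {D}

lemma choiAct_isHermitian (hD : D.IsHermitian) {X : Matrix β β ℂ} (hX : X.IsHermitian) :
    (choiAct D X).IsHermitian := by
  ext a a'
  simp only [choiAct, Matrix.conjTranspose_apply, Matrix.of_apply, star_sum, star_mul']
  rw [Finset.sum_comm]
  simp only [hD.apply, hX.apply]

lemma choiAct_posSemidef [Fintype α] [DecidableEq α] (hD : D.PosSemidef) {X : Matrix β β ℂ}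
    (hX : X.PosSemidef) : (choiAct D X).PosSemidef := by
  have h := ((hD.kronecker hX).submatrix (fun u : α × β => (u, u.2))).mul_mul_conjTranspose_same
    (Matrix.of fun (a : α) (u : α × β) => if u.1 = a then (1 : ℂ) else 0)
  refine (congrArg Matrix.PosSemidef ?_).mpr h
  ext a a'
  simp [choiAct, Matrix.mul_apply, Fintype.sum_prod_type, apply_ite star]
  rw [Finset.sum_comm]

end choiAct

lemma embedAt_isHermitian {N : ℕ} {A : Fin N → ℕ} (m : Fin N)
    {M : Matrix (Fin (A m)) (Fin (A m)) ℂ} (hM : M.IsHermitian) :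
    (embedAt m M : Matrix (∀ k, Fin (A k)) (∀ k, Fin (A k)) ℂ).IsHermitian := by
  ext a b
  simp only [embedAt, Matrix.conjTranspose_apply, Matrix.of_apply, star_mul', hM.apply, star_prod,
    apply_ite star, star_one, star_zero, eq_comm]

lemma linkMat_apply {N : ℕ} {A P B : Fin N → ℕ}
    (C₁ : Matrix ((∀ m, Fin (A m)) × (∀ m, Fin (P m)))
      ((∀ m, Fin (A m)) × (∀ m, Fin (P m))) ℂ)
    (C₂ : Matrix ((∀ m, Fin (P m)) × (∀ m, Fin (B m)))
      ((∀ m, Fin (P m)) × (∀ m, Fin (B m))) ℂ)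
    (x y : (∀ m, Fin (A m)) × (∀ m, Fin (B m))) :
    linkMat C₁ C₂ x y = ∑ q, ∑ p, C₁ (x.1, q) (y.1, p) * C₂ (q, x.2) (p, y.2) := by
  simp only [linkMat, ptTensId, idTens, Matrix.of_apply, Matrix.mul_apply, Fintype.sum_prod_type]
  rw [Finset.sum_comm (s := (Finset.univ : Finset (∀ m, Fin (P m))))]
  rw [Finset.sum_eq_single y.1]
  · rw [Finset.sum_comm]
    simp
  · intro b _ hb
    simp [hb]
  · simp

lemma choiAct_linkMat {N : ℕ} {A P B : Fin N → ℕ}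
    (C₁ : Matrix ((∀ m, Fin (A m)) × (∀ m, Fin (P m)))
      ((∀ m, Fin (A m)) × (∀ m, Fin (P m))) ℂ)
    (C₂ : Matrix ((∀ m, Fin (P m)) × (∀ m, Fin (B m)))
      ((∀ m, Fin (P m)) × (∀ m, Fin (B m))) ℂ)
    (X : Matrix (∀ m, Fin (B m)) (∀ m, Fin (B m)) ℂ) :
    choiAct (linkMat C₁ C₂) X = choiAct C₁ (choiAct C₂ X) := by
  ext a a'
  simp only [choiAct, Matrix.of_apply, linkMat_apply, Finset.sum_mul, Finset.mul_sum, mul_assoc]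
  simp only [← Fintype.sum_prod_type']
  exact Fintype.sum_equiv
    ⟨fun u => (u.2.2.1, u.2.2.2, u.1, u.2.1), fun v => (v.2.2.1, v.2.2.2, v.1, v.2.1),
      fun _ => rfl, fun _ => rfl⟩ _ _ fun _ => rfl

lemma IsComb.ptrSnd_eq_one {N : ℕ} {A B : Fin N → ℕ}
    {C : Matrix ((∀ m, Fin (A m)) × (∀ m, Fin (B m)))
      ((∀ m, Fin (A m)) × (∀ m, Fin (B m))) ℂ} (hC : IsComb C) : ptrSnd C = 1 := by
  obtain ⟨-, Csub, rfl, h0, hstep⟩ := hC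
  suffices H : ∀ (n : ℕ) (h : n ≤ N), ptrSnd (Csub n h) = 1 from H N le_rfl
  intro n
  induction n with
  | zero =>
    intro _
    ext a a'
    rw [h0, Subsingleton.elim a a']
    simp [ptrSnd]
  | succ n ih =>
    intro h
    ext a a'
    have key := congrFun₂ (ih (Nat.le_of_succ_le h)) (Fin.init a) (Fin.init a')
    simp only [ptrSnd, Matrix.of_apply] at key ⊢
    rw [← (Fin.snocEquiv fun m => Fin (B (Fin.castLE h m))).sum_comp, Fintype.sum_prod_type,
      Finset.sum_comm]
    refine (Finset.sum_congr rfl fun c _ => hstep n h a a' c c).trans ?_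
    rw [← Finset.sum_mul]
    refine (congrArg (· * _) key).trans ?_
    have hiff : a = a' ↔ Fin.init a = Fin.init a' ∧ a (Fin.last n) = a' (Fin.last n) := by
      constructor
      · rintro rfl
        simp
      · rintro ⟨h1, h2⟩
        rw [← Fin.snoc_init_self a, ← Fin.snoc_init_self a', h1, h2]
    simp only [Matrix.one_apply, hiff, ite_and, mul_ite, mul_one, mul_zero]
    split_ifs <;> rfl

section lamMax

variable {α : Type*} [DecidableEq α] {M : Matrix α α ℂ}

open scoped MatrixOrder Matrix.Norms.L2Operator in
lemma lamMax_set_nonempty [Fintype α] (hM : M.IsHermitian) :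
    {c : ℝ | ((c : ℂ) • (1 : Matrix α α ℂ) - M).PosSemidef}.Nonempty := by
  have h : M ≤ algebraMap ℝ _ ‖M‖ := IsSelfAdjoint.le_algebraMap_norm_self hM
  rw [Matrix.le_iff, Algebra.algebraMap_eq_smul_one] at h
  refine ⟨‖M‖, ?_⟩
  rw [Set.mem_ofPred_eq, Complex.coe_smul]
  exact h

lemma lamMax_set_bddBelow [Nonempty α] (M : Matrix α α ℂ) :
    BddBelow {c : ℝ | ((c : ℂ) • (1 : Matrix α α ℂ) - M).PosSemidef} := by
  obtain ⟨a⟩ := ‹Nonempty α›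
  refine ⟨(M a a).re, fun c hc => ?_⟩
  have h := (Complex.le_def.1 (hc.diag_nonneg (i := a))).1
  simpa using h

lemma lamMax_le_add [Fintype α] [Nonempty α] {β γ : Type*} [Fintype β] [DecidableEq β] [Fintype γ]
    [DecidableEq γ] {M₁ : Matrix β β ℂ} {M₂ : Matrix γ γ ℂ}
    (h₁ : M₁.IsHermitian) (h₂ : M₂.IsHermitian)
    (h : ∀ c₁ c₂ : ℝ, ((c₁ : ℂ) • (1 : Matrix β β ℂ) - M₁).PosSemidef →
      ((c₂ : ℂ) • (1 : Matrix γ γ ℂ) - M₂).PosSemidef →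
      (((c₁ + c₂ : ℝ) : ℂ) • (1 : Matrix α α ℂ) - M).PosSemidef) :
    lamMax M ≤ lamMax M₁ + lamMax M₂ := by
  rw [← sub_le_iff_le_add]
  refine le_csInf (lamMax_set_nonempty h₁) fun c₁ hc₁ => ?_
  rw [sub_le_comm]
  refine le_csInf (lamMax_set_nonempty h₂) fun c₂ hc₂ => ?_
  rw [sub_le_iff_le_add']
  exact csInf_le (lamMax_set_bddBelow M) (h c₁ c₂ hc₁ hc₂)

end lamMax

/-- Lemma 3 of the paper, local-battery case.
For `N`-step quantum combs `C₁` (input spaces `ℋ_1,…,ℋ_{2N−1}` with Hermitian Hamiltonians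
`HA`, output spaces `ℋ'_2,…,ℋ'_{2N}` with Hermitian Hamiltonians `HP`) and `C₂`
(input spaces `ℋ'_2,…,ℋ'_{2N}`, output spaces `ℋ_2,…,ℋ_{2N}` with Hermitian Hamiltonians
`HB`), the local energy consumption of the concatenation `C₁ * C₂` is subadditive:
`E_loc(C₁ * C₂) ≤ E_loc(C₁) + E_loc(C₂)`. -/
theorem energy_subadditive_link_local
    (N : ℕ) (hN : 1 ≤ N) (A P B : Fin N → ℕ)
    (hA : ∀ m, 0 < A m) (hP : ∀ m, 0 < P m) (hB : ∀ m, 0 < B m)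
    (HA : ∀ m, Matrix (Fin (A m)) (Fin (A m)) ℂ)
    (HP : ∀ m, Matrix (Fin (P m)) (Fin (P m)) ℂ)
    (HB : ∀ m, Matrix (Fin (B m)) (Fin (B m)) ℂ)
    (hHA : ∀ m, (HA m).IsHermitian) (hHP : ∀ m, (HP m).IsHermitian)
    (hHB : ∀ m, (HB m).IsHermitian)
    (C₁ : Matrix ((∀ m, Fin (A m)) × (∀ m, Fin (P m)))
      ((∀ m, Fin (A m)) × (∀ m, Fin (P m))) ℂ)
    (C₂ : Matrix ((∀ m, Fin (P m)) × (∀ m, Fin (B m)))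
      ((∀ m, Fin (P m)) × (∀ m, Fin (B m))) ℂ)
    (hC₁ : IsComb C₁) (hC₂ : IsComb C₂) :
    Eloc HA HB (linkMat C₁ C₂) ≤ Eloc HA HP C₁ + Eloc HP HB C₂ := by
  rw [Eloc, Eloc, Eloc, ← Finset.sum_add_distrib]
  refine Finset.sum_le_sum fun n _ => ?_
  have : Nonempty (∀ m, Fin (A m)) := ⟨fun m => ⟨0, hA m⟩⟩
  simp only [ptrSnd_tens_one_mul, choiAct_linkMat]
  refine max_le ((lamMax_le_add ?_ ?_ fun c₁ c₂ h₁ h₂ => ?_).trans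
    (add_le_add (le_max_left _ _) (le_max_left _ _)))
    (add_nonneg (le_max_right _ _) (le_max_right _ _))
  · exact (choiAct_isHermitian hC₁.1.1 (embedAt_isHermitian n (hHP n)).transpose).sub
      (embedAt_isHermitian n (hHA n)).transpose
  · exact (choiAct_isHermitian hC₂.1.1 (embedAt_isHermitian n (hHB n)).transpose).sub
      (embedAt_isHermitian n (hHP n)).transpose
  · have h := h₁.add (choiAct_posSemidef hC₁.1 h₂)
    rw [choiAct_sub, choiAct_sub, choiAct_smul, choiAct_one, hC₁.ptrSnd_eq_one] at h
    convert h using 1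
    push_cast
    rw [add_smul]
    abel
end
end

section
/- Let d_A ≥ M ≥ 1 be integers, let H_A = Σ_{j=0}^{d_A−1} E_j |e_j⟩⟨e_j| be a Hermitian matrix on ℂ^{d_A} diagonal in the standard basis {e_j}, let F be the discrete Fourier transform on ℂ^{d_A} (F e_j = (1/√d_A) Σ_{l=0}^{d_A−1} e^{2πi jl/d_A} e_l), let ω_M = e^{2πi/M}, and for j = 0,…,M−1 define the vector φ_j := (1/√M) Σ_{k=0}^{M−1} ω_M^{jk} (F e_j) ⊗ (F e_k) ⊗ (F e_k) in ℂ^{d_A} ⊗ ℂ^{d_A} ⊗ ℂ^{d_A}. Then: (a) the family {φ_j}_{j=0}^{M−1} is orthonormal; and (b) with Ē := (Σ_{j=0}^{d_A−1} E_j)/d_A, for all j, j' ∈ {0,…,M−1}, ⟨φ_{j'} | (H_A ⊗ I ⊗ I + I ⊗ H_A ⊗ I + I ⊗ I ⊗ H_A) | φ_j⟩ = 3Ē δ_{j j'}. -/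
noncomputable section

open scoped BigOperators

/-- The entry `⟨e_l, F e_j⟩ = e^{2πi jl/d}/√d` of the discrete Fourier transform on `ℂ^d`,
i.e. the `l`-th coordinate of the vector `F e_j`. -/
def Fe (d : ℕ) (j l : ℕ) : ℂ :=
  Complex.exp (2 * Real.pi * Complex.I * j * l / d) / Real.sqrt d

/-- `ω_M^{ab} = e^{2πi ab/M}`, a power of the `M`-th root of unity. -/
def omg (M a b : ℕ) : ℂ :=
  Complex.exp (2 * Real.pi * Complex.I * a * b / M)

/-- The control-ancilla state
`φ_j = (1/√M) Σ_{k} ω_M^{jk} (F e_j) ⊗ (F e_k) ⊗ (F e_k)` on `ℂ^{d_A} ⊗ ℂ^{d_A} ⊗ ℂ^{d_A}`,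
written as a coordinate function. -/
def phi (dA M : ℕ) (j : Fin M) : Fin dA × Fin dA × Fin dA → ℂ := fun x =>
  (1 / Real.sqrt M : ℂ) *
    ∑ k : Fin M, omg M j k * Fe dA j x.1 * Fe dA k x.2.1 * Fe dA k x.2.2

lemma omg_eq_pow (n a b : ℕ) :
    omg n a b = (Complex.exp (2 * Real.pi * Complex.I / n) ^ a) ^ b := by
  rw [omg, ← Complex.exp_nat_mul, ← Complex.exp_nat_mul]
  congr 1
  ring

lemma conj_omg_mul_self (n a b : ℕ) : (starRingEnd ℂ) (omg n a b) * omg n a b = 1 := by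
  have h : ‖omg n a b‖ = 1 := by
    have harg : 2 * Real.pi * Complex.I * a * b / n
        = ((2 * Real.pi * a * b / n : ℝ) : ℂ) * Complex.I := by
      push_cast
      ring
    rw [omg, harg, Complex.norm_exp_ofReal_mul_I]
  rw [Complex.conj_mul', h]
  simp

/-- Orthogonality of the characters of the cyclic group of order `n`. -/
lemma sum_conj_omg_mul_omg {n : ℕ} (p q : Fin n) :
    ∑ l : Fin n, (starRingEnd ℂ) (omg n p l) * omg n q l = if p = q then (n : ℂ) else 0 := by
  split_ifs with h
  · subst h
    simp [conj_omg_mul_self]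
  have hn : n ≠ 0 := fun h0 => absurd p.isLt (by omega)
  have hζ := Complex.isPrimitiveRoot_exp n hn
  set ζ := Complex.exp (2 * Real.pi * Complex.I / n)
  set z := (starRingEnd ℂ) (ζ ^ (p : ℕ)) * ζ ^ (q : ℕ) with hz
  have hunit : ζ ^ (p : ℕ) * (starRingEnd ℂ) (ζ ^ (p : ℕ)) = 1 := by
    have := conj_omg_mul_self n p 1
    rw [omg_eq_pow, pow_one] at this
    rw [mul_comm]
    exact this
  have hz1 : z ≠ 1 := by
    intro hz1
    apply h
    apply Fin.ext
    refine hζ.pow_inj p.isLt q.isLt ?_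
    calc ζ ^ (p : ℕ) = ζ ^ (p : ℕ) * z := by rw [hz1, mul_one]
      _ = ζ ^ (q : ℕ) := by rw [hz, ← mul_assoc, hunit, one_mul]
  have hzn : z ^ n = 1 := by
    rw [hz, mul_pow, ← map_pow, ← pow_mul, ← pow_mul, mul_comm _ n, mul_comm _ n, pow_mul,
      pow_mul, hζ.pow_eq_one]
    simp
  have hsum : ∀ l : Fin n, (starRingEnd ℂ) (omg n p l) * omg n q l = z ^ (l : ℕ) := by
    intro l
    rw [omg_eq_pow, omg_eq_pow, map_pow, ← mul_pow]
  rw [Finset.sum_congr rfl fun l _ => hsum l, Fin.sum_univ_eq_sum_range (fun l => z ^ l),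
    geom_sum_eq hz1, hzn, sub_self, zero_div]

/-- The matrix element `⟨F e_p, D F e_q⟩` of the diagonal operator `D = Σ_l a_l |e_l⟩⟨e_l|`. -/
def fourierElement (d : ℕ) (a : Fin d → ℂ) (p q : ℕ) : ℂ :=
  ∑ l : Fin d, (starRingEnd ℂ) (Fe d p l) * (a l * Fe d q l)

lemma conj_Fe_mul_Fe (d p q l : ℕ) :
    (starRingEnd ℂ) (Fe d p l) * Fe d q l
      = (starRingEnd ℂ) (omg d p l) * omg d q l / d := by
  have hs : (Real.sqrt d : ℂ) * Real.sqrt d = d := by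
    rw [← Complex.ofReal_mul, Real.mul_self_sqrt (Nat.cast_nonneg d), Complex.ofReal_natCast]
  change (starRingEnd ℂ) (omg d p l / Real.sqrt d) * (omg d q l / Real.sqrt d) = _
  rw [map_div₀, Complex.conj_ofReal, div_mul_div_comm, hs]

lemma fourierElement_self (d : ℕ) (a : Fin d → ℂ) (p : ℕ) :
    fourierElement d a p p = (∑ l, a l) / d := by
  rw [fourierElement, Finset.sum_div]
  refine Finset.sum_congr rfl fun l _ => ?_
  rw [mul_left_comm, conj_Fe_mul_Fe, conj_omg_mul_self, mul_one_div]

lemma fourierElement_one {d : ℕ} {p q : ℕ} (hp : p < d) (hq : q < d) :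
    fourierElement d (fun _ => 1) p q = if p = q then 1 else 0 := by
  have hd : (d : ℂ) ≠ 0 := Nat.cast_ne_zero.mpr (by omega)
  have h := sum_conj_omg_mul_omg (⟨p, hp⟩ : Fin d) ⟨q, hq⟩
  simp only [Fin.mk.injEq] at h
  simp only [fourierElement, one_mul, conj_Fe_mul_Fe]
  rw [← Finset.sum_div, h]
  split_ifs <;> simp [hd]

lemma sum_conj_phi_mul_phi (dA M : ℕ) (a b c : Fin dA → ℂ) (j j' : Fin M) :
    ∑ x : Fin dA × Fin dA × Fin dA,
        (starRingEnd ℂ) (phi dA M j' x) * (a x.1 * b x.2.1 * c x.2.2 * phi dA M j x)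
      = 1 / M * fourierElement dA a j' j * ∑ k' : Fin M, ∑ k : Fin M,
          (starRingEnd ℂ) (omg M j' k') * omg M j k *
            (fourierElement dA b k' k * fourierElement dA c k' k) := by
  have hs : (1 / Real.sqrt M : ℂ) * (1 / Real.sqrt M) = 1 / M := by
    rw [div_mul_div_comm, ← Complex.ofReal_mul, Real.mul_self_sqrt (Nat.cast_nonneg M),
      Complex.ofReal_natCast, one_mul]
  have hexpand : ∀ x : Fin dA × Fin dA × Fin dA,
      (starRingEnd ℂ) (phi dA M j' x) * (a x.1 * b x.2.1 * c x.2.2 * phi dA M j x)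
        = ∑ k' : Fin M, ∑ k : Fin M,
          1 / M * ((starRingEnd ℂ) (omg M j' k') * omg M j k) *
            (((starRingEnd ℂ) (Fe dA j' x.1) * (a x.1 * Fe dA j x.1)) *
            (((starRingEnd ℂ) (Fe dA k' x.2.1) * (b x.2.1 * Fe dA k x.2.1)) *
            ((starRingEnd ℂ) (Fe dA k' x.2.2) * (c x.2.2 * Fe dA k x.2.2)))) := by
    intro x
    simp only [phi, map_mul, map_sum, map_div₀, map_one, Complex.conj_ofReal, Finset.mul_sum,
      Finset.sum_mul]
    rw [Finset.sum_comm]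
    refine Finset.sum_congr rfl fun k' _ => Finset.sum_congr rfl fun k _ => ?_
    rw [← hs]
    ring
  rw [Finset.sum_congr rfl fun x _ => hexpand x, Finset.sum_comm, Finset.mul_sum]
  refine Finset.sum_congr rfl fun k' _ => ?_
  rw [Finset.sum_comm, Finset.mul_sum]
  refine Finset.sum_congr rfl fun k _ => ?_
  rw [← Finset.mul_sum, Fintype.sum_prod_type]
  simp only [Fintype.sum_prod_type, ← Finset.mul_sum, ← Finset.sum_mul]
  simp only [fourierElement]
  ring

/-- If the last two factors contribute diagonally in the Fourier basis, the matrix element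
between control-ancilla states is diagonal. -/
lemma sum_conj_phi_mul_phi_of_diagonal (dA M : ℕ) (a b c : Fin dA → ℂ) (s : ℂ)
    (h : ∀ k' k : Fin M, fourierElement dA b k' k * fourierElement dA c k' k
      = if k' = k then s else 0) (j j' : Fin M) :
    ∑ x : Fin dA × Fin dA × Fin dA,
        (starRingEnd ℂ) (phi dA M j' x) * (a x.1 * b x.2.1 * c x.2.2 * phi dA M j x)
      = (∑ l, a l) / dA * s * (if j = j' then 1 else 0) := by
  have hM : (M : ℂ) ≠ 0 := Nat.cast_ne_zero.mpr fun h0 => absurd j.isLt (by omega)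
  rw [sum_conj_phi_mul_phi]
  simp only [h, mul_ite, mul_zero, Finset.sum_ite_eq, Finset.mem_univ, if_true]
  rw [← Finset.sum_mul, sum_conj_omg_mul_omg]
  by_cases hj : j = j'
  · subst hj
    rw [if_pos rfl, if_pos rfl, fourierElement_self]
    field_simp
  · rw [if_neg hj, if_neg (Ne.symm hj)]
    simp

/-- computational core of Lemma 2 of the paper.
Let `d_A ≥ M ≥ 1`, let `H_A = Σ_j E_j |e_j⟩⟨e_j|` be a Hermitian Hamiltonian diagonal in the
standard basis of `ℂ^{d_A}`, and let `φ_j` be as above.  Then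
(a) the family `{φ_j}_{j<M}` is orthonormal, and
(b) with `Ē = (Σ_j E_j)/d_A`, one has
`⟨φ_{j'}, (H_A⊗I⊗I + I⊗H_A⊗I + I⊗I⊗H_A) φ_j⟩ = 3Ē δ_{jj'}`. -/
theorem control_ancilla_constant_energy
    (dA M : ℕ) (hM : 1 ≤ M) (hdM : M ≤ dA) (E : Fin dA → ℝ) :
    (∀ j j' : Fin M,
      (∑ x : Fin dA × Fin dA × Fin dA,
          (starRingEnd ℂ) (phi dA M j' x) * phi dA M j x)
        = if j = j' then 1 else 0) ∧
    (∀ j j' : Fin M,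
      (∑ x : Fin dA × Fin dA × Fin dA,
          (starRingEnd ℂ) (phi dA M j' x) *
            (((E x.1 + E x.2.1 + E x.2.2 : ℝ) : ℂ) * phi dA M j x))
        = ((3 * ((∑ i, E i) / dA) : ℝ) : ℂ) * (if j = j' then 1 else 0)) := by
  have hd : (dA : ℂ) ≠ 0 := Nat.cast_ne_zero.mpr (by omega)
  have hone : ∀ k' k : Fin M,
      fourierElement dA (fun _ => 1) k' k = if k' = k then 1 else 0 := by
    intro k' k
    rw [fourierElement_one (k'.isLt.trans_le hdM) (k.isLt.trans_le hdM)]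
    simp only [Fin.ext_iff]
  have hdiag : ∀ (a : Fin dA → ℂ) (k' k : Fin M),
      fourierElement dA a k' k * fourierElement dA (fun _ => 1) k' k
        = if k' = k then (∑ l, a l) / dA else 0 := by
    intro a k' k
    rw [hone]
    split_ifs with hk
    · rw [hk, fourierElement_self, mul_one]
    · rw [mul_zero]
  have hmean : (∑ _l : Fin dA, (1 : ℂ)) / dA = 1 := by simp [hd]
  constructor
  · intro j j'
    have h := sum_conj_phi_mul_phi_of_diagonal dA M (fun _ => 1) _ _ _
      (hdiag fun _ => 1) j j'
    simpa only [hmean, one_mul] using h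
  · intro j j'
    have h₁ := sum_conj_phi_mul_phi_of_diagonal dA M (fun l => (E l : ℂ)) _ _ _
      (hdiag fun _ => 1) j j'
    have h₂ := sum_conj_phi_mul_phi_of_diagonal dA M (fun _ => 1) _ _ _
      (hdiag fun l => (E l : ℂ)) j j'
    have h₃ := sum_conj_phi_mul_phi_of_diagonal dA M (fun _ => 1) _ _ _
      (fun k' k => (mul_comm _ _).trans (hdiag (fun l => (E l : ℂ)) k' k)) j j'
    simp only [hmean, one_mul, mul_one] at h₁ h₂ h₃
    simp only [Complex.ofReal_add, add_mul, mul_add, Finset.sum_add_distrib]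
    rw [h₁, h₂, h₃]
    push_cast
    ring
end
end

section
/- Define the 2×2 matrices H := |1⟩⟨1| (single nonzero entry H[1,1] = 1) and T¹ := I_2/2, and the 4×4 matrices (rows/columns indexed by (Fin 2 × Fin 2) in the order (0,0),(0,1),(1,0),(1,1)) T_0 with diagonal (1/4, 0, 1/2, 1/4) and entries 1/4 at positions ((0,0),(1,1)) and ((1,1),(0,0)), all other entries zero, and T_1 with diagonal (1/4, 1/2, 0, 1/4) and entries −1/4 at positions ((0,0),(1,1)) and ((1,1),(0,0)), all other entries zero. Set T := T_0 ⊗ |0⟩⟨0| + T_1 ⊗ |1⟩⟨1| (an 8×8 matrix on ℂ²⊗ℂ²⊗ℂ²). Then: T_0 and T_1 are positive semidefinite; T_0 + T_1 = T¹ ⊗ I_2; Tr[T¹] = 1; Tr[H T¹] ≤ 3/4; Tr_{1,3}[(H ⊗ I_2 ⊗ I_2 + I_2 ⊗ I_2 ⊗ H) T] ⪯ H^T + (3/4)·I_2; and Tr[T_0 𝒥] = 1/4 where 𝒥 := |0⟩⟨1| ⊗ |0⟩⟨1|. -/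
noncomputable section

open scoped BigOperators ComplexOrder

/-- Partial trace over the first and third tensor factors of a matrix on a triple
tensor product, yielding a matrix on the second factor. -/
def ptr13 {α β γ : Type*} [Fintype α] [Fintype γ]
    (M : Matrix ((α × β) × γ) ((α × β) × γ) ℂ) : Matrix β β ℂ :=
  Matrix.of fun b b' => ∑ a : α, ∑ c : γ, M ((a, b), c) ((a, b'), c)

/-- The rank-one projector `|x⟩⟨x|` onto an energy eigenstate of a qubit. -/
def ketbra (x : Fin 2) : Matrix (Fin 2) (Fin 2) ℂ :=
  Matrix.of fun c c' => if c = x ∧ c' = x then 1 else 0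

/-- The qubit Hamiltonian `H = |1⟩⟨1|`. -/
def Hq : Matrix (Fin 2) (Fin 2) ℂ :=
  Matrix.of fun i j => if i = 1 ∧ j = 1 then 1 else 0

/-- The task operator `𝒥 = |0⟩⟨1| ⊗ |0⟩⟨1|`. -/
def Jqubit : Matrix (Fin 2 × Fin 2) (Fin 2 × Fin 2) ℂ :=
  Matrix.of fun p q =>
    if p = ((0 : Fin 2), (0 : Fin 2)) ∧ q = ((1 : Fin 2), (1 : Fin 2)) then 1 else 0

/-- `T¹ = I/2`. -/
def ToneOpt : Matrix (Fin 2) (Fin 2) ℂ := (1 / 2 : ℂ) • 1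

/-- The optimal instrument element `T₀` for `E ≥ 3/4`: diagonal `(1/4, 0, 1/2, 1/4)` in the
basis order `(0,0),(0,1),(1,0),(1,1)` with corner entries `1/4`. -/
def T0opt : Matrix (Fin 2 × Fin 2) (Fin 2 × Fin 2) ℂ :=
  Matrix.of fun p q =>
    if p = q then
      (if p = ((0 : Fin 2), (0 : Fin 2)) then 1 / 4
        else if p = ((0 : Fin 2), (1 : Fin 2)) then 0
        else if p = ((1 : Fin 2), (0 : Fin 2)) then 1 / 2
        else 1 / 4)
    else if (p = ((0 : Fin 2), (0 : Fin 2)) ∧ q = ((1 : Fin 2), (1 : Fin 2))) ∨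
        (p = ((1 : Fin 2), (1 : Fin 2)) ∧ q = ((0 : Fin 2), (0 : Fin 2))) then 1 / 4
    else 0

/-- The optimal instrument element `T₁` for `E ≥ 3/4`: diagonal `(1/4, 1/2, 0, 1/4)` with
corner entries `−1/4`. -/
def T1opt : Matrix (Fin 2 × Fin 2) (Fin 2 × Fin 2) ℂ :=
  Matrix.of fun p q =>
    if p = q then
      (if p = ((0 : Fin 2), (0 : Fin 2)) then 1 / 4
        else if p = ((0 : Fin 2), (1 : Fin 2)) then 1 / 2
        else if p = ((1 : Fin 2), (0 : Fin 2)) then 0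
        else 1 / 4)
    else if (p = ((0 : Fin 2), (0 : Fin 2)) ∧ q = ((1 : Fin 2), (1 : Fin 2))) ∨
        (p = ((1 : Fin 2), (1 : Fin 2)) ∧ q = ((0 : Fin 2), (0 : Fin 2))) then -(1 / 4)
    else 0

/-- The probe comb `T = T₀ ⊗ |0⟩⟨0| + T₁ ⊗ |1⟩⟨1|` on `ℂ²⊗ℂ²⊗ℂ²`. -/
def Topt : Matrix ((Fin 2 × Fin 2) × Fin 2) ((Fin 2 × Fin 2) × Fin 2) ℂ :=
  tens T0opt (ketbra 0) + tens T1opt (ketbra 1)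

/-- A nonnegative diagonal matrix plus a matrix `u u⋆` is positive semidefinite. -/
theorem posSemidef_diagonal_add_vecMulVec {n : Type*} [Fintype n] [DecidableEq n]
    {d : n → ℂ} (hd : 0 ≤ d) (u : n → ℂ) :
    (Matrix.diagonal d + Matrix.vecMulVec u (star u)).PosSemidef :=
  (Matrix.PosSemidef.diagonal hd).add (Matrix.posSemidef_vecMulVec_self_star u)

theorem single_half_nonneg {n : Type*} [DecidableEq n] (i : n) :
    (0 : n → ℂ) ≤ Pi.single i (1 / 2) :=
  Pi.single_nonneg.2 (by norm_num [Complex.le_def])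

theorem T0opt_eq :
    T0opt = Matrix.diagonal (Pi.single (1, 0) (1 / 2)) +
      Matrix.vecMulVec (Pi.single (0, 0) (1 / 2) + Pi.single (1, 1) (1 / 2))
        (star (Pi.single (0, 0) (1 / 2) + Pi.single (1, 1) (1 / 2))) := by
  ext ⟨a, b⟩ ⟨c, d⟩
  fin_cases a <;> fin_cases b <;> fin_cases c <;> fin_cases d <;>
    norm_num [T0opt, Matrix.diagonal, Matrix.vecMulVec, Pi.single_apply,
      Complex.conj_ofNat]

theorem T1opt_eq :
    T1opt = Matrix.diagonal (Pi.single (0, 1) (1 / 2)) +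
      Matrix.vecMulVec (Pi.single (0, 0) (1 / 2) - Pi.single (1, 1) (1 / 2))
        (star (Pi.single (0, 0) (1 / 2) - Pi.single (1, 1) (1 / 2))) := by
  ext ⟨a, b⟩ ⟨c, d⟩
  fin_cases a <;> fin_cases b <;> fin_cases c <;> fin_cases d <;>
    norm_num [T1opt, Matrix.diagonal, Matrix.vecMulVec, Pi.single_apply,
      Complex.conj_ofNat]

theorem T0opt_add_T1opt : T0opt + T1opt = tens ToneOpt 1 := by
  ext ⟨a, b⟩ ⟨c, d⟩
  fin_cases a <;> fin_cases b <;> fin_cases c <;> fin_cases d <;>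
    norm_num [T0opt, T1opt, tens, ToneOpt, Matrix.one_apply]

/-- The slack in the energy constraint is `|1⟩⟨1| / 2`. -/
theorem energy_slack_eq :
    Hq.transpose + ((3 / 4 : ℂ)) • 1 -
      ptr13 ((tens (tens Hq 1) 1 + tens (tens 1 1) Hq) * Topt) =
    Matrix.diagonal (Pi.single 1 (1 / 2)) := by
  ext a b
  fin_cases a <;> fin_cases b <;>
    norm_num [ptr13, Topt, T0opt, T1opt, tens, ketbra, Hq, Matrix.mul_apply, Matrix.one_apply,
      Fintype.sum_prod_type, Fin.sum_univ_two, Matrix.diagonal]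

/-- attainability half of Lemma 7 / Theorem 6 of the paper for `E ≥ 3/4`.
The explicit data `(T₀, T₁, T¹)` above is a valid `3/4`-globally energy-constrained probe comb
for qubit phase estimation and achieves `Tr[T₀ 𝒥] = 1/4`. -/
theorem qubit_phase_optimal_probe_high_energy :
    T0opt.PosSemidef ∧
    T1opt.PosSemidef ∧
    T0opt + T1opt = tens ToneOpt 1 ∧
    ToneOpt.trace = 1 ∧
    ((Hq * ToneOpt).trace).re ≤ 3 / 4 ∧
    (Hq.transpose + ((3 / 4 : ℂ)) • 1 -
      ptr13 ((tens (tens Hq 1) 1 + tens (tens 1 1) Hq) * Topt)).PosSemidef ∧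
    (T0opt * Jqubit).trace = 1 / 4 := by
  refine ⟨?_, ?_, T0opt_add_T1opt, ?_, ?_, ?_, ?_⟩
  · rw [T0opt_eq]
    exact posSemidef_diagonal_add_vecMulVec (single_half_nonneg _) _
  · rw [T1opt_eq]
    exact posSemidef_diagonal_add_vecMulVec (single_half_nonneg _) _
  · simp [ToneOpt]
  · norm_num [ToneOpt, Hq, Matrix.trace, Matrix.one_apply]
  · rw [energy_slack_eq]
    exact Matrix.PosSemidef.diagonal (single_half_nonneg _)
  · norm_num [Matrix.trace, Matrix.mul_apply, T0opt, Jqubit, Fintype.sum_prod_type]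
end
end

section
/- Let 0 ≤ E ≤ 3/4 and set κ := 1 − √(1−E). Define the 2×2 matrices H := |1⟩⟨1| and T¹ := diag(1−κ, κ), and the 4×4 matrices (indexed by (Fin 2 × Fin 2) in the order (0,0),(0,1),(1,0),(1,1)) T_0 with diagonal ((1−κ)², 0, κ, κ²) and entries κ(1−κ) at positions ((0,0),(1,1)) and ((1,1),(0,0)), all other entries zero, and T_1 with diagonal (κ(1−κ), 1−κ, 0, κ(1−κ)) and entries −κ(1−κ) at positions ((0,0),(1,1)) and ((1,1),(0,0)), all other entries zero. Set T := T_0 ⊗ |0⟩⟨0| + T_1 ⊗ |1⟩⟨1|. Then: T_0 and T_1 are positive semidefinite; T_0 + T_1 = T¹ ⊗ I_2; Tr[T¹] = 1; Tr[H T¹] = κ ≤ E; Tr_{1,3}[(H ⊗ I_2 ⊗ I_2 + I_2 ⊗ I_2 ⊗ H) T] ⪯ H^T + E·I_2; and Tr[T_0 𝒥] = κ(1−κ) where 𝒥 := |0⟩⟨1| ⊗ |0⟩⟨1|. -/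
noncomputable section

open scoped BigOperators ComplexOrder

/-- `T¹ = diag(1−κ, κ)`. -/
def ToneKappa (κ : ℝ) : Matrix (Fin 2) (Fin 2) ℂ :=
  Matrix.diagonal fun i => if i = 0 then ((1 - κ : ℝ) : ℂ) else ((κ : ℝ) : ℂ)

/-- The optimal instrument element `T₀` for `E ≤ 3/4`: diagonal `((1−κ)², 0, κ, κ²)` in the
basis order `(0,0),(0,1),(1,0),(1,1)` with corner entries `κ(1−κ)`. -/
def T0kappa (κ : ℝ) : Matrix (Fin 2 × Fin 2) (Fin 2 × Fin 2) ℂ :=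
  Matrix.of fun p q =>
    if p = q then
      (if p = ((0 : Fin 2), (0 : Fin 2)) then (((1 - κ) ^ 2 : ℝ) : ℂ)
        else if p = ((0 : Fin 2), (1 : Fin 2)) then 0
        else if p = ((1 : Fin 2), (0 : Fin 2)) then ((κ : ℝ) : ℂ)
        else ((κ ^ 2 : ℝ) : ℂ))
    else if (p = ((0 : Fin 2), (0 : Fin 2)) ∧ q = ((1 : Fin 2), (1 : Fin 2))) ∨
        (p = ((1 : Fin 2), (1 : Fin 2)) ∧ q = ((0 : Fin 2), (0 : Fin 2))) then
      ((κ * (1 - κ) : ℝ) : ℂ)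
    else 0

/-- The optimal instrument element `T₁` for `E ≤ 3/4`: diagonal `(κ(1−κ), 1−κ, 0, κ(1−κ))`
with corner entries `−κ(1−κ)`. -/
def T1kappa (κ : ℝ) : Matrix (Fin 2 × Fin 2) (Fin 2 × Fin 2) ℂ :=
  Matrix.of fun p q =>
    if p = q then
      (if p = ((0 : Fin 2), (0 : Fin 2)) then ((κ * (1 - κ) : ℝ) : ℂ)
        else if p = ((0 : Fin 2), (1 : Fin 2)) then ((1 - κ : ℝ) : ℂ)
        else if p = ((1 : Fin 2), (0 : Fin 2)) then 0
        else ((κ * (1 - κ) : ℝ) : ℂ))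
    else if (p = ((0 : Fin 2), (0 : Fin 2)) ∧ q = ((1 : Fin 2), (1 : Fin 2))) ∨
        (p = ((1 : Fin 2), (1 : Fin 2)) ∧ q = ((0 : Fin 2), (0 : Fin 2))) then
      (-(κ * (1 - κ) : ℝ) : ℂ)
    else 0

/-- `T₀` is the rank-one operator of `(1−κ)|00⟩ + κ|11⟩` plus `κ|10⟩⟨10|`. -/
theorem T0kappa_posSemidef {κ : ℝ} (hκ : 0 ≤ κ) : (T0kappa κ).PosSemidef := by
  let v : Fin 2 × Fin 2 → ℂ := fun p =>
    if p = (0, 0) then ((1 - κ : ℝ) : ℂ) else if p = (1, 1) then (κ : ℂ) else 0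
  let d : Fin 2 × Fin 2 → ℂ := fun p => if p = (1, 0) then (κ : ℂ) else 0
  have hd : (Matrix.diagonal d).PosSemidef := by
    refine Matrix.PosSemidef.diagonal fun p => ?_
    simp only [d, Pi.zero_apply]
    split_ifs
    · exact_mod_cast hκ
    · exact le_rfl
  have h : T0kappa κ = Matrix.vecMulVec v (star v) + Matrix.diagonal d := by
    ext ⟨a, b⟩ ⟨c, e⟩
    fin_cases a <;> fin_cases b <;> fin_cases c <;> fin_cases e <;>
      simp [T0kappa, v, d, Matrix.vecMulVec_apply] <;> ring
  rw [h]
  exact (Matrix.posSemidef_vecMulVec_self_star v).add hd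

/-- `T₁` is `κ(1−κ)` times the rank-one operator of `|00⟩ − |11⟩` plus `(1−κ)|01⟩⟨01|`. -/
theorem T1kappa_posSemidef {κ : ℝ} (hκ : 0 ≤ κ) (hκ1 : κ ≤ 1) : (T1kappa κ).PosSemidef := by
  let w : Fin 2 × Fin 2 → ℂ := fun p =>
    if p = (0, 0) then 1 else if p = (1, 1) then -1 else 0
  let d : Fin 2 × Fin 2 → ℂ := fun p => if p = (0, 1) then ((1 - κ : ℝ) : ℂ) else 0
  have hd : (Matrix.diagonal d).PosSemidef := by
    refine Matrix.PosSemidef.diagonal fun p => ?_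
    simp only [d, Pi.zero_apply]
    split_ifs
    · exact_mod_cast sub_nonneg.2 hκ1
    · exact le_rfl
  have hc : (0 : ℂ) ≤ ((κ * (1 - κ) : ℝ) : ℂ) := by
    exact_mod_cast mul_nonneg hκ (sub_nonneg.2 hκ1)
  have h : T1kappa κ =
      ((κ * (1 - κ) : ℝ) : ℂ) • Matrix.vecMulVec w (star w) + Matrix.diagonal d := by
    ext ⟨a, b⟩ ⟨c, e⟩
    fin_cases a <;> fin_cases b <;> fin_cases c <;> fin_cases e <;>
      simp [T1kappa, w, d, Matrix.vecMulVec_apply]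
  rw [h]
  exact ((Matrix.posSemidef_vecMulVec_self_star w).smul hc).add hd

theorem T0kappa_add_T1kappa (κ : ℝ) : T0kappa κ + T1kappa κ = tens (ToneKappa κ) 1 := by
  ext ⟨a, b⟩ ⟨c, e⟩
  fin_cases a <;> fin_cases b <;> fin_cases c <;> fin_cases e <;>
    simp [T0kappa, T1kappa, tens, ToneKappa] <;> ring

/-- The total-energy operator on the first and third factors is diagonal. -/
theorem totalEnergy_eq_diagonal :
    tens (tens Hq (1 : Matrix (Fin 2) (Fin 2) ℂ)) (1 : Matrix (Fin 2) (Fin 2) ℂ) +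
      tens (tens 1 1) Hq =
    Matrix.diagonal fun p : (Fin 2 × Fin 2) × Fin 2 =>
      (if p.1.1 = 1 then 1 else 0) + (if p.2 = 1 then 1 else 0) := by
  ext ⟨⟨a, b⟩, c⟩ ⟨⟨a', b'⟩, c'⟩
  fin_cases a <;> fin_cases b <;> fin_cases c <;> fin_cases a' <;> fin_cases b' <;>
    fin_cases c' <;> simp [tens, Hq]

theorem ptr13_energy_eq (κ : ℝ) :
    ptr13 ((tens (tens Hq 1) 1 + tens (tens 1 1) Hq) *
        (tens (T0kappa κ) (ketbra 0) + tens (T1kappa κ) (ketbra 1))) =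
      Matrix.diagonal fun i =>
        if i = 0 then ((1 - (1 - κ) ^ 2 : ℝ) : ℂ) else ((1 + κ - κ ^ 2 : ℝ) : ℂ) := by
  rw [totalEnergy_eq_diagonal]
  ext b b'
  fin_cases b <;> fin_cases b' <;>
    simp [ptr13, Matrix.diagonal_mul, tens, ketbra, T0kappa, T1kappa] <;> ring

/-- attainability half of Theorem 6 of the paper, `E ≤ 3/4`.
With `κ = 1 − √(1−E)`, the explicit data `(T₀, T₁, T¹)` above is a valid `E`-globally
energy-constrained probe comb for qubit phase estimation and achieves
`Tr[T₀ 𝒥] = κ(1−κ)`. -/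
theorem qubit_phase_optimal_probe_low_energy
    (E κ : ℝ) (hE0 : 0 ≤ E) (hE : E ≤ 3 / 4) (hκ : κ = 1 - Real.sqrt (1 - E)) :
    (T0kappa κ).PosSemidef ∧
    (T1kappa κ).PosSemidef ∧
    T0kappa κ + T1kappa κ = tens (ToneKappa κ) 1 ∧
    (ToneKappa κ).trace = 1 ∧
    ((Hq * ToneKappa κ).trace).re = κ ∧ κ ≤ E ∧
    (Hq.transpose + ((E : ℂ)) • 1 -
      ptr13 ((tens (tens Hq 1) 1 + tens (tens 1 1) Hq) *
        (tens (T0kappa κ) (ketbra 0) + tens (T1kappa κ) (ketbra 1)))).PosSemidef ∧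
    (T0kappa κ * Jqubit).trace = ((κ * (1 - κ) : ℝ) : ℂ) := by
  have hs0 : 0 ≤ Real.sqrt (1 - E) := Real.sqrt_nonneg _
  have hs1 : Real.sqrt (1 - E) ≤ 1 := Real.sqrt_le_one.2 (by linarith)
  have hκ0 : 0 ≤ κ := by linarith
  have hκ1 : κ ≤ 1 := by linarith
  have hEκ : E = 1 - (1 - κ) ^ 2 := by
    rw [hκ, sub_sub_cancel, Real.sq_sqrt (by linarith)]
    ring
  refine ⟨T0kappa_posSemidef hκ0, T1kappa_posSemidef hκ0 hκ1, T0kappa_add_T1kappa κ, ?_, ?_,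
    by nlinarith, ?_, ?_⟩
  · simp [ToneKappa, Matrix.trace, Fin.sum_univ_two]
  · simp [ToneKappa, Hq, Matrix.trace, Fin.sum_univ_two]
  · have h : Hq.transpose + (E : ℂ) • 1 -
        ptr13 ((tens (tens Hq 1) 1 + tens (tens 1 1) Hq) *
          (tens (T0kappa κ) (ketbra 0) + tens (T1kappa κ) (ketbra 1))) =
        Matrix.diagonal fun i => if i = 0 then 0 else (κ : ℂ) := by
      rw [ptr13_energy_eq, hEκ]
      ext i j
      fin_cases i <;> fin_cases j <;> simp [Hq]
      ring
    rw [h]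
    refine Matrix.PosSemidef.diagonal fun i => ?_
    simp only [Pi.zero_apply]
    split_ifs
    · exact le_rfl
    · exact_mod_cast hκ0
  · simp [T0kappa, Jqubit, Matrix.trace, Matrix.mul_apply, Fintype.sum_prod_type,
      Fin.sum_univ_two]
end
end

section
/- Let d ≥ 2 and E ≥ 0. Let H_d be the d×d diagonal matrix with H_d[n,n] = n for n = 0,…,d−1, and let A_d be the d×d symmetric tridiagonal matrix with zero diagonal and all off-diagonal entries equal to 1/2. Suppose T¹ (d×d) and T_x for x = 0,…,d−1 (each d²×d² on ℂ^d ⊗ ℂ^d) are complex matrices, with T := Σ_{x=0}^{d−1} T_x ⊗ |x⟩⟨x| on ℂ^d ⊗ ℂ^d ⊗ ℂ^d, satisfying: T ⪰ 0; Tr_3[T] = T¹ ⊗ I_d; Tr[T¹] = 1; Tr[H_d T¹] ≤ E; and Tr_{1,3}[(H_d ⊗ I_d ⊗ I_d + I_d ⊗ I_d ⊗ H_d) T] ⪯ H_d^T + E·I_d. Let 𝒥_d := Σ_{j=1}^{d−1} |j−1, j−1⟩⟨j, j|. Then for every function θ̂ : {0,…,d−1} → ℝ and every γ ≥ 0, Σ_{x=0}^{d−1}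 Re[ e^{i θ̂(x)} Tr[T_x 𝒥_d] ] ≤ (1/2)·( E·γ − λ_min(γ·H_d + 2·A_d) ). -/
noncomputable section

open scoped BigOperators ComplexOrder

/-- The equally-spaced Hamiltonian `H_d = diag(0,1,…,d−1)` over `ℂ`. -/
def Hdc (d : ℕ) : Matrix (Fin d) (Fin d) ℂ :=
  Matrix.diagonal fun n => ((n : ℕ) : ℂ)

/-- The equally-spaced Hamiltonian `H_d = diag(0,1,…,d−1)` over `ℝ`. -/
def Hdr (d : ℕ) : Matrix (Fin d) (Fin d) ℝ :=
  Matrix.diagonal fun n => ((n : ℕ) : ℝ)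

/-- The symmetric tridiagonal matrix `A_d` with zero diagonal and off-diagonal entries `1/2`. -/
def Adr (d : ℕ) : Matrix (Fin d) (Fin d) ℝ :=
  Matrix.of fun i j => if (i : ℕ) + 1 = (j : ℕ) ∨ (j : ℕ) + 1 = (i : ℕ) then 1 / 2 else 0

/-- The smallest eigenvalue of a real symmetric matrix, characterized via the Loewner order:
`lamMinR M` is the greatest real `c` such that `M − c·I` is positive semidefinite. -/
def lamMinR {α : Type*} [Fintype α] [DecidableEq α] (M : Matrix α α ℝ) : ℝ :=
  sSup {c : ℝ | (M - c • 1).PosSemidef}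

/-- The task operator `𝒥_d = Σ_{j=1}^{d−1} |j−1,j−1⟩⟨j,j|` for `d`-dimensional phase
estimation. -/
def Jd (d : ℕ) : Matrix (Fin d × Fin d) (Fin d × Fin d) ℂ :=
  Matrix.of fun p q =>
    if p.1 = p.2 ∧ q.1 = q.2 ∧ (p.1 : ℕ) + 1 = (q.1 : ℕ) then 1 else 0

/-- The Cauchy–Schwarz bound on the entries of a positive semidefinite matrix. -/
theorem posSemidef_norm_apply_le {n : Type*} {M : Matrix n n ℂ} (hM : M.PosSemidef) (i j : n) :
    ‖M i j‖ ≤ √(M i i).re * √(M j j).re := by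
  have h := (hM.submatrix ![i, j]).det_nonneg
  simp only [Matrix.det_fin_two, Matrix.submatrix_apply, Matrix.cons_val_zero,
    Matrix.cons_val_one] at h
  have hi : 0 ≤ M i i := hM.diag_nonneg
  have hj : 0 ≤ M j j := hM.diag_nonneg
  rw [Complex.le_def] at hi hj
  have hji : M j i = star (M i j) := (hM.1.apply j i).symm
  have hre := (Complex.le_def.1 h).1
  rw [hji] at hre
  simp only [Complex.zero_re, Complex.sub_re, Complex.mul_re, ← hi.2, Complex.zero_im,
    Complex.star_def, Complex.conj_re, Complex.conj_im] at hre
  rw [← Real.sqrt_mul hi.1]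
  refine Real.le_sqrt_of_sq_le ?_
  rw [Complex.sq_norm, Complex.normSq_apply]
  linarith

/-- A real symmetric matrix dominates some multiple of the identity. -/
theorem exists_posSemidef_sub_smul_one {α : Type*} [Fintype α] [DecidableEq α]
    {M : Matrix α α ℝ} (hM : M.IsHermitian) : ∃ c : ℝ, (M - c • 1).PosSemidef := by
  refine ⟨-∑ i, ∑ j, |M i j|, .of_dotProduct_mulVec_nonneg ?_ fun x => ?_⟩
  · exact hM.sub (Matrix.isHermitian_one.smul (IsSelfAdjoint.all _))
  have hx (i : α) : x i ^ 2 ≤ ∑ k, x k ^ 2 :=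
    Finset.single_le_sum (f := fun k => x k ^ 2) (fun k _ => sq_nonneg _) (Finset.mem_univ i)
  have hterm (i j : α) : 0 ≤ x i * (M i j * x j) + |M i j| * ∑ k, x k ^ 2 := by
    have h1 : |x i * x j| ≤ ∑ k, x k ^ 2 := by
      rw [abs_le]
      constructor <;> nlinarith [hx i, hx j, sq_nonneg (x i + x j), sq_nonneg (x i - x j)]
    have h2 := mul_le_mul_of_nonneg_left h1 (abs_nonneg (M i j))
    rw [← abs_mul] at h2
    nlinarith [neg_abs_le (M i j * (x i * x j))]
  have hsum := Finset.sum_nonneg fun i (_ : i ∈ Finset.univ) =>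
    Finset.sum_nonneg fun j (_ : j ∈ Finset.univ) => hterm i j
  refine hsum.trans_eq ?_
  simp only [Finset.sum_add_distrib, ← Finset.sum_mul, ← Finset.mul_sum, neg_smul,
    sub_neg_eq_add, Matrix.add_mulVec, Matrix.smul_mulVec, Matrix.one_mulVec, dotProduct_add,
    dotProduct_smul, smul_eq_mul, star_trivial]
  simp only [dotProduct, Matrix.mulVec, sq]

/-- The variational upper bound on the smallest eigenvalue by a unit vector. -/
theorem lamMinR_le {α : Type*} [Fintype α] [DecidableEq α] {M : Matrix α α ℝ}
    (hM : M.IsHermitian) (v : α → ℝ) (hv : v ⬝ᵥ v = 1) : lamMinR M ≤ v ⬝ᵥ (M.mulVec v) := by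
  refine csSup_le (exists_posSemidef_sub_smul_one hM) fun c hc => ?_
  have h := Matrix.PosSemidef.dotProduct_mulVec_nonneg hc v
  simpa [Matrix.sub_mulVec, Matrix.smul_mulVec, dotProduct_sub, hv] using h

theorem isHermitian_smul_Hdr_add_Adr (d : ℕ) (γ : ℝ) :
    (γ • Hdr d + (2 : ℝ) • Adr d).IsHermitian := by
  ext i j
  have hswap : ((j : ℕ) + 1 = i ∨ (i : ℕ) + 1 = j) ↔ ((i : ℕ) + 1 = j ∨ (j : ℕ) + 1 = i) :=
    or_comm
  by_cases hij : i = j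
  · subst hij; simp
  · simp [Hdr, Adr, hij, Ne.symm hij, hswap]

/-- The quadratic form of `γ H_d + 2 A_d` at a vector with alternating signs. -/
theorem alternating_dotProduct_mulVec (d : ℕ) (γ : ℝ) (v : Fin d → ℝ) :
    (fun i : Fin d => (-1) ^ (i : ℕ) * v i) ⬝ᵥ
        ((γ • Hdr d + (2 : ℝ) • Adr d).mulVec fun i : Fin d => (-1) ^ (i : ℕ) * v i) =
      γ * ∑ i : Fin d, (i : ℕ) * v i ^ 2 -
        2 * ∑ i : Fin d, ∑ j : Fin d, if (j : ℕ) + 1 = i then v i * v j else 0 := by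
  have hs (i : ℕ) : ((-1 : ℝ) ^ i) * (-1) ^ i = 1 := by rw [← mul_pow]; simp
  have hA (i j : Fin d) : (-1) ^ (i : ℕ) * v i * (Adr d i j * ((-1) ^ (j : ℕ) * v j)) =
      -(1 / 2) * ((if (j : ℕ) + 1 = i then v i * v j else 0) +
        if (i : ℕ) + 1 = j then v j * v i else 0) := by
    by_cases h1 : (j : ℕ) + 1 = i
    · have h2 : ¬ (i : ℕ) + 1 = j := by omega
      simp only [Adr, Matrix.of_apply, h1, h2, or_true, if_true, if_false]
      rw [← h1, pow_succ]
      linear_combination (-(1 / 2) * v i * v j) * hs j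
    · by_cases h2 : (i : ℕ) + 1 = j
      · simp only [Adr, Matrix.of_apply, h1, h2, true_or, if_true, if_false]
        rw [← h2, pow_succ]
        linear_combination (-(1 / 2) * v i * v j) * hs i
      · simp [Adr, h1, h2]
  have hquad : (fun i : Fin d => (-1) ^ (i : ℕ) * v i) ⬝ᵥ
      ((Adr d).mulVec fun i : Fin d => (-1) ^ (i : ℕ) * v i) =
      -∑ i : Fin d, ∑ j : Fin d, if (j : ℕ) + 1 = i then v i * v j else 0 := by
    simp only [dotProduct, Matrix.mulVec, Finset.mul_sum, hA]
    simp only [← Finset.mul_sum, Finset.sum_add_distrib]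
    rw [Finset.sum_comm (f := fun i j : Fin d => if (i : ℕ) + 1 = j then v j * v i else 0)]
    ring
  have hH : (fun i : Fin d => (-1) ^ (i : ℕ) * v i) ⬝ᵥ
      ((Hdr d).mulVec fun i : Fin d => (-1) ^ (i : ℕ) * v i) = ∑ i : Fin d, (i : ℕ) * v i ^ 2 := by
    simp only [dotProduct, Hdr, Matrix.mulVec_diagonal]
    refine Finset.sum_congr rfl fun i _ => ?_
    linear_combination ((i : ℕ) * v i ^ 2 : ℝ) * hs i
  simp only [Matrix.add_mulVec, Matrix.smul_mulVec, dotProduct_add, dotProduct_smul, hquad, hH,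
    smul_eq_mul]
  ring

theorem trace_mul_Jd (d : ℕ) (M : Matrix (Fin d × Fin d) (Fin d × Fin d) ℂ) :
    (M * Jd d).trace =
      ∑ i : Fin d, ∑ j : Fin d, if (j : ℕ) + 1 = i then M (i, i) (j, j) else 0 := by
  simp only [Matrix.trace, Matrix.diag_apply, Matrix.mul_apply, Fintype.sum_prod_type, Jd,
    Matrix.of_apply, mul_ite, mul_one, mul_zero, ite_and, Finset.sum_ite_eq,
    Finset.mem_univ, if_true]
  refine Finset.sum_congr rfl fun i _ => ?_
  rw [Finset.sum_comm]
  simp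

/-- Lemma 6 of the paper.
For any `E`-globally energy-constrained probe comb `(T¹, {T_x})` for `d`-dimensional phase
estimation with equally spaced Hamiltonian `H_d`, any estimator `θ̂` and any `γ ≥ 0`,
`Σ_x Re[e^{iθ̂(x)} Tr[T_x 𝒥_d]] ≤ (1/2)(Eγ − λ_min(γH_d + 2A_d))`. -/
theorem phase_estimation_cost_lower_bound
    (d : ℕ) (hd : 2 ≤ d) (E : ℝ) (hE : 0 ≤ E)
    (Tone : Matrix (Fin d) (Fin d) ℂ)
    (Tx : Fin d → Matrix (Fin d × Fin d) (Fin d × Fin d) ℂ)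
    (T : Matrix ((Fin d × Fin d) × Fin d) ((Fin d × Fin d) × Fin d) ℂ)
    (hTdef : T = ∑ x : Fin d,
      tens (Tx x) (Matrix.of fun c c' => if c = x ∧ c' = x then (1 : ℂ) else 0))
    (hTpsd : T.PosSemidef)
    (hTr3 : ptrSnd T = tens Tone 1)
    (htr : Tone.trace = 1)
    (hstate : ((Hdc d * Tone).trace).re ≤ E)
    (hstep : ((Hdc d).transpose + ((E : ℂ)) • 1 -
      ptr13 ((tens (tens (Hdc d) 1) 1 + tens (tens 1 1) (Hdc d)) * T)).PosSemidef) :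
    ∀ (θ : Fin d → ℝ) (γ : ℝ), 0 ≤ γ →
      (∑ x : Fin d, (Complex.exp (Complex.I * (θ x : ℂ)) * (Tx x * Jd d).trace).re)
        ≤ (1 / 2) * (E * γ - lamMinR (γ • Hdr d + (2 : ℝ) • Adr d)) := by
  intro θ γ hγ
  have hTapp (x : Fin d) (p q : Fin d × Fin d) : T (p, x) (q, x) = Tx x p q := by
    simp [hTdef, Matrix.sum_apply, tens]
  have hdiag (i x : Fin d) : 0 ≤ (T ((i, i), x) ((i, i), x)).re :=
    (Complex.le_def.1 (hTpsd.diag_nonneg (i := ((i, i), x)))).1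
  have hp (i : Fin d) : ∑ x, (T ((i, i), x) ((i, i), x)).re = (Tone i i).re := by
    have h := congrFun (congrFun hTr3 (i, i)) (i, i)
    simp only [ptrSnd, tens, Matrix.of_apply, Matrix.one_apply_eq, mul_one] at h
    rw [← h, Complex.re_sum]
  have hp0 (i : Fin d) : 0 ≤ (Tone i i).re := hp i ▸ Finset.sum_nonneg fun x _ => hdiag i x
  have hpsum : ∑ i, (Tone i i).re = 1 := by
    simpa [Matrix.trace] using congrArg Complex.re htr
  have henergy : ∑ i : Fin d, (i : ℕ) * (Tone i i).re ≤ E := by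
    simpa [Matrix.trace, Hdc, Matrix.diagonal_mul] using hstate
  have hterm (x i j : Fin d) : (Complex.exp (Complex.I * (θ x : ℂ)) * Tx x (i, i) (j, j)).re ≤
      √(T ((i, i), x) ((i, i), x)).re * √(T ((j, j), x) ((j, j), x)).re := by
    refine (Complex.re_le_norm _).trans ?_
    rw [norm_mul, mul_comm Complex.I, Complex.norm_exp_ofReal_mul_I, one_mul, ← hTapp]
    exact posSemidef_norm_apply_le hTpsd _ _
  have hcost : (∑ x : Fin d, (Complex.exp (Complex.I * (θ x : ℂ)) * (Tx x * Jd d).trace).re) ≤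
      ∑ i : Fin d, ∑ j : Fin d,
        if (j : ℕ) + 1 = i then √(Tone i i).re * √(Tone j j).re else 0 := by
    simp only [trace_mul_Jd, Finset.mul_sum, Complex.re_sum]
    rw [Finset.sum_comm]
    refine Finset.sum_le_sum fun i _ => ?_
    rw [Finset.sum_comm]
    refine Finset.sum_le_sum fun j _ => ?_
    split_ifs
    · rw [← hp i, ← hp j]
      exact (Finset.sum_le_sum fun x _ => hterm x i j).trans
        (Real.sum_sqrt_mul_sqrt_le _ (hdiag i) (hdiag j))
    · simp
  have hunit : (fun i : Fin d => (-1) ^ (i : ℕ) * √(Tone i i).re) ⬝ᵥ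
      (fun i : Fin d => (-1) ^ (i : ℕ) * √(Tone i i).re) = 1 := by
    refine (Finset.sum_congr rfl fun i _ => ?_).trans hpsum
    rw [mul_mul_mul_comm, ← mul_pow, Real.mul_self_sqrt (hp0 i)]
    simp
  have hmin := lamMinR_le (isHermitian_smul_Hdr_add_Adr d γ) _ hunit
  rw [alternating_dotProduct_mulVec d γ fun i => √(Tone i i).re] at hmin
  simp only [Real.sq_sqrt (hp0 _)] at hmin
  linarith [mul_le_mul_of_nonneg_left henergy hγ]
end
end

section
/- Let γ ≥ 0. For d ≥ 1, let H_d be the d×d diagonal matrix with H_d[n,n] = n for n = 0,…,d−1, and let A_d be the d×d symmetric tridiagonal matrix with zero diagonal and off-diagonal entries 1/2. Then: (a) λ_min(γ·H_d + 2·A_d) ∈ [−2, 0] for every d, and λ_min(γ·H_d + 2·A_d) < 0 for every d ≥ 2; (b) the sequence d ↦ λ_min(γ·H_d + 2·A_d) is non-increasing; (c) consequently the limit λ̂_min^γ := lim_{d→∞} λ_min(γ·H_d + 2·A_d) exists and lies in [−2, 0). -/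
noncomputable section

open scoped BigOperators

/-- The matrix `γ·H_d + 2·A_d`. -/
def Mgd (γ : ℝ) (d : ℕ) : Matrix (Fin d) (Fin d) ℝ :=
  γ • Hdr d + (2 : ℝ) • Adr d

theorem posSemidef_two_smul_one_add_Adr (d : ℕ) :
    ((2 : ℝ) • (1 : Matrix (Fin d) (Fin d) ℝ) + (2 : ℝ) • Adr d).PosSemidef := by
  let B : Matrix (Fin d) (Fin (d + 1)) ℝ := Matrix.of fun i k =>
    (if k = i.castSucc then 1 else 0) + (if k = i.succ then 1 else 0)
  have hB : (2 : ℝ) • (1 : Matrix (Fin d) (Fin d) ℝ) + (2 : ℝ) • Adr d = B * B.conjTranspose := by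
    ext i j
    simp only [B, Matrix.mul_apply, Matrix.conjTranspose_apply, Matrix.of_apply, star_trivial,
      add_mul, Finset.sum_add_distrib, ite_mul, one_mul, zero_mul, Finset.sum_ite_eq',
      Finset.mem_univ, if_true, Matrix.add_apply, Matrix.smul_apply,
      Matrix.one_apply, Adr, smul_eq_mul]
    simp only [Fin.ext_iff, Fin.val_castSucc, Fin.val_succ]
    split_ifs <;> first | omega | norm_num
  rw [hB]
  exact Matrix.posSemidef_self_mul_conjTranspose B

theorem posSemidef_Mgd_sub_neg_two {γ : ℝ} (hγ : 0 ≤ γ) (d : ℕ) :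
    (Mgd γ d - (-2 : ℝ) • 1).PosSemidef := by
  have hH : (Hdr d).PosSemidef := Matrix.PosSemidef.diagonal fun n => Nat.cast_nonneg (n : ℕ)
  have h := (hH.smul hγ).add (posSemidef_two_smul_one_add_Adr d)
  convert h using 1
  rw [Mgd, neg_smul]
  abel

theorem Mgd_sub_smul_one_submatrix_castLE (γ c : ℝ) {m d : ℕ} (h : m ≤ d) :
    (Mgd γ d - c • 1).submatrix (Fin.castLE h) (Fin.castLE h) = Mgd γ m - c • 1 := by
  ext i j
  simp [Mgd, Hdr, Adr, Matrix.one_apply, Matrix.diagonal_apply, Fin.ext_iff]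

theorem posSemidef_Mgd_sub_mono {γ c : ℝ} {m d : ℕ} (h : m ≤ d)
    (hc : (Mgd γ d - c • 1).PosSemidef) : (Mgd γ m - c • 1).PosSemidef :=
  Mgd_sub_smul_one_submatrix_castLE γ c h ▸ hc.submatrix (Fin.castLE h)

theorem nonpos_of_posSemidef_Mgd_sub {γ c : ℝ} {d : ℕ} (hd : 1 ≤ d)
    (hc : (Mgd γ d - c • 1).PosSemidef) : c ≤ 0 := by
  have h := (posSemidef_Mgd_sub_mono hd hc).diag_nonneg (i := 0)
  simpa [Mgd, Hdr, Adr] using h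

theorem le_of_posSemidef_Mgd_sub {γ c : ℝ} {d : ℕ} (hd : 2 ≤ d)
    (hc : (Mgd γ d - c • 1).PosSemidef) : c ≤ -(2 + γ) / ((1 + γ) ^ 2 + 1) := by
  have h := (posSemidef_Mgd_sub_mono hd hc).dotProduct_mulVec_nonneg ![1 + γ, -1]
  simp [Mgd, Hdr, Adr, Matrix.mulVec, dotProduct, Fin.sum_univ_two] at h
  rw [le_div_iff₀ (by positivity)]
  nlinarith [h]

theorem lamMinR_Mgd_antitone {γ : ℝ} (hγ : 0 ≤ γ) {m d : ℕ} (hm : 1 ≤ m) (h : m ≤ d) :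
    lamMinR (Mgd γ d) ≤ lamMinR (Mgd γ m) :=
  csSup_le_csSup ⟨0, fun _ hc => nonpos_of_posSemidef_Mgd_sub hm hc⟩
    ⟨-2, posSemidef_Mgd_sub_neg_two hγ d⟩ fun _ hc => posSemidef_Mgd_sub_mono h hc

theorem neg_two_le_lamMinR_Mgd {γ : ℝ} (hγ : 0 ≤ γ) {d : ℕ} (hd : 1 ≤ d) :
    -2 ≤ lamMinR (Mgd γ d) :=
  le_csSup ⟨0, fun _ hc => nonpos_of_posSemidef_Mgd_sub hd hc⟩ (posSemidef_Mgd_sub_neg_two hγ d)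

theorem lamMinR_Mgd_nonpos {γ : ℝ} (hγ : 0 ≤ γ) {d : ℕ} (hd : 1 ≤ d) :
    lamMinR (Mgd γ d) ≤ 0 :=
  csSup_le ⟨-2, posSemidef_Mgd_sub_neg_two hγ d⟩ fun _ hc => nonpos_of_posSemidef_Mgd_sub hd hc

theorem lamMinR_Mgd_neg {γ : ℝ} (hγ : 0 ≤ γ) {d : ℕ} (hd : 2 ≤ d) :
    lamMinR (Mgd γ d) < 0 :=
  (csSup_le ⟨-2, posSemidef_Mgd_sub_neg_two hγ d⟩ fun _ hc =>
    le_of_posSemidef_Mgd_sub hd hc).trans_lt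
      (div_neg_of_neg_of_pos (by linarith) (by positivity))

/-- Lemma 9 of the paper.
For any `γ ≥ 0`: (a) `λ_min(γH_d + 2A_d) ∈ [−2,0]` for every `d ≥ 1`, and it is negative
for every `d ≥ 2`; (b) the sequence `d ↦ λ_min(γH_d + 2A_d)` is non-increasing;
(c) consequently the limit `λ̂_min^γ` exists and lies in `[−2, 0)`. -/
theorem tridiagonal_min_eigenvalue_convergence (γ : ℝ) (hγ : 0 ≤ γ) :
    (∀ d : ℕ, 1 ≤ d → lamMinR (Mgd γ d) ∈ Set.Icc (-2 : ℝ) 0) ∧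
    (∀ d : ℕ, 2 ≤ d → lamMinR (Mgd γ d) < 0) ∧
    (∀ d : ℕ, 1 ≤ d → lamMinR (Mgd γ (d + 1)) ≤ lamMinR (Mgd γ d)) ∧
    (∃ L ∈ Set.Ico (-2 : ℝ) 0,
      Filter.Tendsto (fun d : ℕ => lamMinR (Mgd γ d)) Filter.atTop (nhds L)) := by
  refine ⟨fun d hd => ⟨neg_two_le_lamMinR_Mgd hγ hd, lamMinR_Mgd_nonpos hγ hd⟩,
    fun d hd => lamMinR_Mgd_neg hγ hd,
    fun d hd => lamMinR_Mgd_antitone hγ hd d.le_succ, ?_⟩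
  have hanti : Antitone fun d : ℕ => lamMinR (Mgd γ (d + 2)) :=
    fun m d h => lamMinR_Mgd_antitone hγ (by omega) (by omega)
  have hbdd : BddBelow (Set.range fun d : ℕ => lamMinR (Mgd γ (d + 2))) :=
    ⟨-2, Set.forall_mem_range.2 fun d => neg_two_le_lamMinR_Mgd hγ (by omega)⟩
  refine ⟨⨅ d : ℕ, lamMinR (Mgd γ (d + 2)),
    ⟨le_ciInf fun d => neg_two_le_lamMinR_Mgd hγ (by omega),
      (ciInf_le hbdd 0).trans_lt (lamMinR_Mgd_neg hγ le_rfl)⟩, ?_⟩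
  exact (Filter.tendsto_add_atTop_iff_nat (f := fun d : ℕ => lamMinR (Mgd γ d)) 2).1
    (tendsto_atTop_ciInf hanti hbdd)
end
end

section
/- Let γ > 0. Let H_d be the d×d diagonal matrix with entries 0,1,…,d−1 and A_d the d×d symmetric tridiagonal matrix with zero diagonal and off-diagonal entries 1/2, and let λ̂ := lim_{d→∞} λ_min(γ·H_d + 2·A_d) (this limit exists and lies in [−2,0)). Then λ̂ is a zero of the Bessel function of the first kind of order −λ̂/γ − 1 evaluated at 2/γ; explicitly, Σ_{k=0}^{∞} (−1)^k / ( k! · Γ(k − λ̂/γ) ) · (1/γ)^{2k − λ̂/γ − 1} = 0, where Γ is the real Gamma function and the power is the real power function (the base 1/γ is positive). -/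
noncomputable section

open scoped BigOperators

/-- The coefficients of the (rescaled) Lommel polynomials. -/
def lommelCoeff (ν : ℝ) (n k : ℕ) : ℝ :=
  ((n - k).choose k : ℝ) * ∏ j ∈ Finset.Ico k (n - k), (ν + j)

lemma lommelCoeff_eq_zero (ν : ℝ) {n k : ℕ} (h : n < 2 * k) : lommelCoeff ν n k = 0 := by
  have h' : n - k < k := by omega
  simp [lommelCoeff, Nat.choose_eq_zero_of_lt h']

lemma lommelCoeff_zero_right (ν : ℝ) (n : ℕ) :
    lommelCoeff ν n 0 = ∏ j ∈ Finset.range n, (ν + j) := by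
  simp [lommelCoeff]

lemma lommelCoeff_succ_succ (ν : ℝ) (n k : ℕ) :
    lommelCoeff ν (n + 2) (k + 1) =
      (ν + (n + 1)) * lommelCoeff ν (n + 1) (k + 1) + lommelCoeff ν n k := by
  rcases lt_or_ge n (2 * k) with h | h
  · rw [lommelCoeff_eq_zero ν (by omega : n + 2 < 2 * (k + 1)),
      lommelCoeff_eq_zero ν (by omega : n + 1 < 2 * (k + 1)), lommelCoeff_eq_zero ν h]
    ring
  · obtain ⟨m, rfl⟩ : ∃ m, n = m + k := ⟨n - k, by omega⟩
    have hkm : k ≤ m := by omega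
    simp only [lommelCoeff]
    rw [show m + k + 2 - (k + 1) = m + 1 by omega, show m + k + 1 - (k + 1) = m by omega,
      show m + k - k = m by omega]
    rcases hkm.eq_or_lt with rfl | hlt
    · simp
    · rw [Finset.prod_Ico_succ_top (by omega : k + 1 ≤ m), Finset.prod_eq_prod_Ico_succ_bot hlt,
        Nat.choose_succ_succ]
      have hc : (m.choose (k + 1) : ℝ) * (k + 1) = m.choose k * (m - k) := by
        have := congrArg (Nat.cast (R := ℝ)) (Nat.choose_succ_right_eq m k)
        push_cast [Nat.cast_sub hkm] at this
        exact this
      push_cast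
      linear_combination (-∏ j ∈ Finset.Ico (k + 1) m, (ν + (j : ℝ))) * hc

/-- The Lommel polynomials, rescaled so that `lommelPoly ν s (n + 2)` equals
`(ν + n + 1) * lommelPoly ν s (n + 1) - s * lommelPoly ν s n`. -/
def lommelPoly (ν s : ℝ) (n : ℕ) : ℝ :=
  ∑ k ∈ Finset.range (n + 1), (-s) ^ k * lommelCoeff ν n k

lemma lommelPoly_zero (ν s : ℝ) : lommelPoly ν s 0 = 1 := by
  simp [lommelPoly, lommelCoeff]

lemma lommelPoly_one (ν s : ℝ) : lommelPoly ν s 1 = ν := by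
  simp [lommelPoly, lommelCoeff, Finset.sum_range_succ]

lemma lommelPoly_add_two (ν s : ℝ) (n : ℕ) :
    lommelPoly ν s (n + 2) =
      (ν + (n + 1)) * lommelPoly ν s (n + 1) - s * lommelPoly ν s n := by
  have h1 : lommelPoly ν s (n + 1) =
      ∑ k ∈ Finset.range (n + 3), (-s) ^ k * lommelCoeff ν (n + 1) k := by
    rw [Finset.sum_range_succ, lommelCoeff_eq_zero ν (by omega : n + 1 < 2 * (n + 2))]
    simp [lommelPoly]
  have h2 : lommelPoly ν s n =
      ∑ k ∈ Finset.range (n + 2), (-s) ^ k * lommelCoeff ν n k := by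
    rw [Finset.sum_range_succ, lommelCoeff_eq_zero ν (by omega : n < 2 * (n + 1))]
    simp [lommelPoly]
  rw [h1, h2, lommelPoly, Finset.sum_range_succ', Finset.sum_range_succ' _ (n + 2), mul_add,
    Finset.mul_sum, Finset.mul_sum, lommelCoeff_zero_right, lommelCoeff_zero_right,
    Finset.prod_range_succ _ (n + 1), add_sub_right_comm, ← Finset.sum_sub_distrib]
  congr 1
  · refine Finset.sum_congr rfl fun k _ => ?_
    rw [lommelCoeff_succ_succ]
    ring
  · push_cast
    ring

lemma prod_add_natCast_pos {ν : ℝ} (hν : 0 < ν) (s : Finset ℕ) : 0 < ∏ j ∈ s, (ν + j) :=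
  Finset.prod_pos fun j _ => by positivity

lemma min_one_le_prod_add_natCast {ν : ℝ} (hν : 0 < ν) (k : ℕ) :
    min 1 ν ≤ ∏ j ∈ Finset.range k, (ν + j) := by
  cases k with
  | zero => simp
  | succ k =>
    induction k with
    | zero => simp
    | succ k ih =>
      rw [Finset.prod_range_succ]
      refine ih.trans (le_mul_of_one_le_right (prod_add_natCast_pos hν _).le ?_)
      push_cast
      linarith [(Nat.cast_nonneg k : (0 : ℝ) ≤ k)]

lemma lommelCoeff_div_prod {ν : ℝ} (hν : 0 < ν) {n k : ℕ} (h : 2 * k ≤ n) :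
    lommelCoeff ν n k / ∏ j ∈ Finset.range n, (ν + j) =
      (∏ i ∈ Finset.range k, (((n - k - i : ℕ) : ℝ) / (ν + (n - k + i : ℕ)))) /
        (k.factorial * ∏ j ∈ Finset.range k, (ν + j)) := by
  have h1 := prod_add_natCast_pos hν (Finset.range k)
  have h2 := prod_add_natCast_pos hν (Finset.Ico k (n - k))
  have h3 := prod_add_natCast_pos hν (Finset.Ico (n - k) n)
  have h4 : (k.factorial : ℝ) ≠ 0 := by positivity
  have hd : ∏ i ∈ Finset.range k, ((n - k - i : ℕ) : ℝ) = k.factorial * (n - k).choose k := by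
    rw [← Nat.cast_prod, ← Nat.descFactorial_eq_prod_range,
      Nat.descFactorial_eq_factorial_mul_choose, Nat.cast_mul]
  have hp : ∏ i ∈ Finset.range k, (ν + (n - k + i : ℕ)) =
      ∏ j ∈ Finset.Ico (n - k) n, (ν + (j : ℝ)) := by
    rw [Finset.prod_Ico_eq_prod_range, show n - (n - k) = k by omega]
  rw [Finset.prod_div_distrib, hd, hp,
    ← Finset.prod_range_mul_prod_Ico _ (Nat.sub_le n k),
    ← Finset.prod_range_mul_prod_Ico _ (by omega : k ≤ n - k), lommelCoeff]
  field_simp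

lemma abs_lommelCoeff_div_prod_le {ν : ℝ} (hν : 0 < ν) (n k : ℕ) :
    |lommelCoeff ν n k / ∏ j ∈ Finset.range n, (ν + j)| ≤ 1 / (k.factorial * min 1 ν) := by
  have hm : 0 < min 1 ν := lt_min one_pos hν
  rcases lt_or_ge n (2 * k) with h | h
  · rw [lommelCoeff_eq_zero ν h]
    simp only [zero_div, abs_zero]
    positivity
  · have h1 := prod_add_natCast_pos hν (Finset.range k)
    rw [lommelCoeff_div_prod hν h, abs_of_nonneg (by positivity)]
    gcongr
    · refine Finset.prod_le_one (fun i _ => by positivity) fun i _ => ?_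
      refine div_le_one_of_le₀ ?_ (by positivity)
      have : ((n - k - i : ℕ) : ℝ) ≤ (n - k + i : ℕ) := by exact_mod_cast (by omega)
      linarith
    · exact min_one_le_prod_add_natCast hν k

lemma tendsto_lommelCoeff_div_prod {ν : ℕ → ℝ} {ν₀ : ℝ} (hν₀ : 0 < ν₀)
    (hν : Filter.Tendsto ν Filter.atTop (nhds ν₀)) (k : ℕ) :
    Filter.Tendsto (fun n => lommelCoeff (ν n) n k / ∏ j ∈ Finset.range n, (ν n + j))
      Filter.atTop (nhds (1 / (k.factorial * ∏ j ∈ Finset.range k, (ν₀ + j)))) := by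
  have hpos : ∀ᶠ n in Filter.atTop, 0 < ν n := hν.eventually (lt_mem_nhds hν₀)
  have hfac : ∀ i : ℕ, Filter.Tendsto
      (fun n => ((n - k - i : ℕ) : ℝ) / (ν n + (n - k + i : ℕ))) Filter.atTop (nhds 1) := by
    intro i
    have hden : Filter.Tendsto (fun n => ν n + ((n - k + i : ℕ) : ℝ))
        Filter.atTop Filter.atTop :=
      hν.add_atTop (tendsto_natCast_atTop_atTop.comp
        (Filter.tendsto_atTop_mono (fun n => Nat.le_add_right (n - k) i)
          (Filter.tendsto_sub_atTop_nat k)))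
    have hlim := ((hν.add_const (2 * (i : ℝ))).div_atTop hden).const_sub 1
    rw [sub_zero] at hlim
    refine hlim.congr' ?_
    filter_upwards [hpos, Filter.eventually_ge_atTop (k + i)] with n hn hki
    have hne : ν n + ((n - k + i : ℕ) : ℝ) ≠ 0 := by positivity
    rw [eq_div_iff hne, sub_mul, div_mul_cancel₀ _ hne, Nat.cast_sub (by omega)]
    push_cast
    ring
  have hnum := tendsto_finsetProd (Finset.range k) fun i _ => hfac i
  have hden : Filter.Tendsto
      (fun n => (k.factorial : ℝ) * ∏ j ∈ Finset.range k, (ν n + (j : ℝ))) Filter.atTop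
      (nhds (k.factorial * ∏ j ∈ Finset.range k, (ν₀ + (j : ℝ)))) :=
    (tendsto_finsetProd (Finset.range k) fun j _ => hν.add_const (j : ℝ)).const_mul _
  have hne : (k.factorial : ℝ) * ∏ j ∈ Finset.range k, (ν₀ + (j : ℝ)) ≠ 0 :=
    mul_ne_zero (by positivity) (prod_add_natCast_pos hν₀ _).ne'
  have hlim := hnum.div hden hne
  rw [Finset.prod_const_one] at hlim
  refine hlim.congr' ?_
  filter_upwards [hpos, Filter.eventually_ge_atTop (2 * k)] with n hn hk
  exact (lommelCoeff_div_prod hn hk).symm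

/-- A limit of zeros `ν n` of the Lommel polynomials of degree `n` is a zero of the
(normalized) Bessel series. -/
lemma hasSum_bessel_of_tendsto_lommelPoly_zero {ν : ℕ → ℝ} {ν₀ : ℝ} (hν₀ : 0 < ν₀)
    (hν : Filter.Tendsto ν Filter.atTop (nhds ν₀)) {s : ℝ}
    (hzero : ∀ᶠ n in Filter.atTop, lommelPoly (ν n) s n = 0) :
    HasSum (fun k : ℕ => (-s) ^ k * (1 / (k.factorial * ∏ j ∈ Finset.range k, (ν₀ + (j : ℝ)))))
      0 := by
  have hm : 0 < min 1 (ν₀ / 2) := lt_min one_pos (half_pos hν₀)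
  have hbound : Summable fun k : ℕ => |s| ^ k / k.factorial * (1 / min 1 (ν₀ / 2)) :=
    (Real.summable_pow_div_factorial |s|).mul_right _
  have hle : ∀ {ν : ℝ}, ν₀ / 2 ≤ ν → ∀ k : ℕ,
      1 / (k.factorial * min 1 ν) ≤ 1 / (k.factorial * min 1 (ν₀ / 2)) := by
    intro ν hν k
    gcongr
  have htend := tendsto_tsum_of_dominated_convergence hbound
    (fun k => (tendsto_lommelCoeff_div_prod hν₀ hν k).const_mul ((-s) ^ k)) (by
      filter_upwards [hν.eventually (le_mem_nhds (half_lt_self hν₀))] with n hn k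
      rw [norm_mul, norm_pow, norm_neg, Real.norm_eq_abs, Real.norm_eq_abs]
      calc _ ≤ |s| ^ k * (1 / (k.factorial * min 1 (ν₀ / 2))) := by
            gcongr
            exact (abs_lommelCoeff_div_prod_le (by linarith) n k).trans (hle hn k)
        _ = _ := by field_simp)
  have hsum : Summable fun k : ℕ =>
      (-s) ^ k * (1 / (k.factorial * ∏ j ∈ Finset.range k, (ν₀ + (j : ℝ)))) := by
    refine hbound.of_norm_bounded fun k => ?_
    have hp := prod_add_natCast_pos hν₀ (Finset.range k)
    rw [norm_mul, norm_pow, norm_neg, Real.norm_eq_abs, Real.norm_eq_abs,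
      abs_of_pos (a := 1 / _) (by positivity)]
    calc _ ≤ |s| ^ k * (1 / (k.factorial * min 1 (ν₀ / 2))) := by
          gcongr
          exact (min_le_min_left 1 (half_le_self hν₀.le)).trans
            (min_one_le_prod_add_natCast hν₀ k)
      _ = _ := by field_simp
  have hz : Filter.Tendsto (fun n => ∑' k, (-s) ^ k *
      (lommelCoeff (ν n) n k / ∏ j ∈ Finset.range n, (ν n + (j : ℝ))))
      Filter.atTop (nhds 0) := by
    refine tendsto_const_nhds.congr' ?_
    filter_upwards [hzero] with n hn
    rw [tsum_eq_sum (s := Finset.range (n + 1))]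
    · simp_rw [← mul_div_assoc]
      rw [← Finset.sum_div, ← lommelPoly, hn, zero_div]
    · intro k hk
      rw [Finset.mem_range] at hk
      rw [lommelCoeff_eq_zero _ (by omega)]
      simp
  rw [← tendsto_nhds_unique htend hz]
  exact hsum.hasSum

lemma Mgd_apply (γ : ℝ) (d : ℕ) (i j : Fin d) :
    Mgd γ d i j = (if (i : ℕ) = j then γ * (i : ℕ) else 0) +
      (if (i : ℕ) + 1 = j then 1 else 0) + (if (j : ℕ) + 1 = i then 1 else 0) := by
  simp only [Mgd, Hdr, Adr, Matrix.add_apply, Matrix.smul_apply, Matrix.diagonal_apply,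
    Matrix.of_apply, smul_eq_mul, Fin.ext_iff]
  split_ifs <;> first | omega | simp_all

lemma Mgd_isHermitian (γ : ℝ) (d : ℕ) : (Mgd γ d).IsHermitian := by
  ext i j
  simp only [Matrix.conjTranspose_apply, star_trivial, Mgd_apply]
  split_ifs <;> first | omega | simp_all

lemma posSemidef_sub_smul_one_iff {α : Type*} [Fintype α] [DecidableEq α] {M : Matrix α α ℝ}
    (hM : M.IsHermitian) (c : ℝ) :
    (M - c • 1).PosSemidef ↔ c ∈ lowerBounds (spectrum ℝ M) := by
  have hH : (M - c • (1 : Matrix α α ℝ)).IsHermitian :=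
    hM.sub (by simp [Matrix.IsHermitian])
  rw [Matrix.posSemidef_iff_isHermitian_and_spectrum_nonneg, ← Algebra.algebraMap_eq_smul_one,
    ← spectrum.sub_singleton_eq]
  rw [← Algebra.algebraMap_eq_smul_one] at hH
  simp only [hH, true_and, Set.sub_singleton, Set.image_subset_iff]
  exact forall₂_congr fun x _ => sub_nonneg (a := x) (b := c)

lemma isLeast_lamMinR {α : Type*} [Fintype α] [DecidableEq α] [Nonempty α]
    {M : Matrix α α ℝ} (hM : M.IsHermitian) : IsLeast (spectrum ℝ M) (lamMinR M) := by
  have hne : (spectrum ℝ M).Nonempty := by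
    rw [hM.spectrum_real_eq_range_eigenvalues]
    exact Set.range_nonempty _
  have hfin : (spectrum ℝ M).Finite := Matrix.finite_real_spectrum
  have h : lamMinR M = sInf (spectrum ℝ M) := by
    simp only [lamMinR, posSemidef_sub_smul_one_iff hM]
    exact csSup_lowerBounds_eq_csInf hfin.bddBelow hne
  rw [h]
  exact ⟨hne.csInf_mem hfin, fun x hx => csInf_le hfin.bddBelow hx⟩

lemma lamMinR_Mgd_le {γ : ℝ} (hγ : 0 < γ) {d : ℕ} (hd : 2 ≤ d) :
    lamMinR (Mgd γ d) ≤ -(1 / (γ + 1)) := by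
  have : Nonempty (Fin d) := ⟨⟨0, by omega⟩⟩
  have hP := ((posSemidef_sub_smul_one_iff (Mgd_isHermitian γ d) _).mpr
    (isLeast_lamMinR (Mgd_isHermitian γ d)).2).submatrix (Fin.castLE hd)
  set c := lamMinR (Mgd γ d)
  have h0 := hP.diag_nonneg (i := 0)
  have h1 := hP.det_nonneg
  simp only [Matrix.det_fin_two, Matrix.submatrix_apply, Matrix.sub_apply, Matrix.smul_apply,
    Matrix.one_apply, Mgd_apply, Fin.ext_iff, Fin.val_castLE] at h0 h1
  norm_num at h0 h1
  by_contra! hc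
  have hlt : -c < 1 / (γ + 1) := by linarith
  rw [lt_div_iff₀ (by linarith)] at hlt
  have hc1 : -c < 1 := by nlinarith
  nlinarith

/-- A solution of the three-term eigenvalue recurrence is a multiple of the Lommel polynomials. -/
lemma eq_lommelPoly_of_recurrence {γ x : ℝ} (hγ : 0 < γ) {d : ℕ} {w : ℕ → ℝ}
    (h0 : 0 < d → w 1 = x * w 0)
    (hrec : ∀ i, i + 1 < d → γ * (i + 1) * w (i + 1) + w (i + 2) + w i = x * w (i + 1)) :
    ∀ k ≤ d, w k = (-γ) ^ k * lommelPoly (-x / γ) ((1 / γ) ^ 2) k * w 0 := by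
  intro k
  induction k using Nat.twoStepInduction with
  | zero => simp [lommelPoly_zero]
  | one =>
    intro hd
    rw [h0 (by omega), lommelPoly_one]
    field_simp
  | more k ih₀ ih₁ =>
    intro hd
    have hr := hrec k (by omega)
    have e₀ := ih₀ (by omega)
    have e₁ := ih₁ (by omega)
    have hw : w (k + 2) = x * w (k + 1) - γ * (k + 1) * w (k + 1) - w k := by linarith
    rw [hw, e₀, e₁, lommelPoly_add_two]
    field_simp
    ring

lemma lommelPoly_eq_zero_of_mem_spectrum {γ x : ℝ} (hγ : 0 < γ) {d : ℕ}
    (hx : x ∈ spectrum ℝ (Mgd γ d)) : lommelPoly (-x / γ) ((1 / γ) ^ 2) d = 0 := by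
  have hdet : (algebraMap ℝ (Matrix (Fin d) (Fin d) ℝ) x - Mgd γ d).det = 0 := by
    rw [spectrum.mem_iff, Matrix.isUnit_iff_isUnit_det, isUnit_iff_ne_zero, not_not] at hx
    exact hx
  obtain ⟨v, hv, hMv⟩ := Matrix.exists_mulVec_eq_zero_iff.mpr hdet
  rw [Matrix.sub_mulVec, sub_eq_zero, Algebra.algebraMap_eq_smul_one, Matrix.smul_mulVec,
    Matrix.one_mulVec] at hMv
  set w : ℕ → ℝ := fun k => if h : k < d then v ⟨k, h⟩ else 0 with hw
  have hwv : ∀ i : Fin d, w i = v i := fun i => by simp [hw]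
  have hwd : ∀ k, d ≤ k → w k = 0 := fun k hk => by simp [hw, hk]
  have hrow : ∀ i, i < d → γ * i * w i + w (i + 1) +
      (∑ j ∈ Finset.range d, if j + 1 = i then w j else 0) = x * w i := by
    intro i hi
    have h := congrFun hMv ⟨i, hi⟩
    simp only [Pi.smul_apply, smul_eq_mul, Matrix.mulVec, dotProduct, Mgd_apply, ← hwv] at h
    rw [Fin.sum_univ_eq_sum_range (fun j => ((if i = j then γ * i else 0) +
      (if i + 1 = j then 1 else 0) + (if j + 1 = i then 1 else 0)) * w j) d] at h
    simp only [add_mul, ite_mul, one_mul, zero_mul, Finset.sum_add_distrib, Finset.sum_ite_eq,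
      Finset.mem_range, hi, if_true] at h
    rw [h]
    congr 2
    split_ifs with h'
    · rfl
    · exact hwd _ (by omega)
  have hsol := eq_lommelPoly_of_recurrence (γ := γ) (x := x) (w := w) (d := d) hγ
    (fun hd => by simpa using hrow 0 hd)
    (fun i hi => by
      have h := hrow (i + 1) hi
      simp only [add_left_inj, Finset.sum_ite_eq', Finset.mem_range, show i < d by omega,
        if_true] at h
      push_cast at h
      exact h)
  have hd := hsol d le_rfl
  rw [hwd d le_rfl] at hd
  have hw0 : w 0 ≠ 0 := by
    intro h0
    refine hv (funext fun i => ?_)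
    rw [← hwv, hsol i i.2.le, h0, mul_zero, Pi.zero_apply]
  have hγd : (-γ) ^ d ≠ 0 := pow_ne_zero _ (neg_ne_zero.mpr hγ.ne')
  simpa [hw0, hγd, hγ.ne'] using hd.symm

lemma Gamma_natCast_add {ν : ℝ} (hν : 0 < ν) (k : ℕ) :
    Real.Gamma (k + ν) = Real.Gamma ν * ∏ j ∈ Finset.range k, (ν + j) := by
  induction k with
  | zero => simp
  | succ k ih =>
    rw [Finset.prod_range_succ, ← mul_assoc, ← ih, Nat.cast_succ,
      show (k : ℝ) + 1 + ν = (k + ν) + 1 by ring, Real.Gamma_add_one (by positivity)]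
    ring

/-- Lemma 10 of the paper.
Let `γ > 0` and let `λ̂ = lim_{d→∞} λ_min(γH_d + 2A_d)`.  Then `λ̂` is a zero of the Bessel
function of the first kind of order `−λ̂/γ − 1` at the point `2/γ`:
`Σ_{k=0}^{∞} (−1)^k/(k!·Γ(k − λ̂/γ))·(1/γ)^(2k − λ̂/γ − 1) = 0`. -/
theorem limit_eigenvalue_is_bessel_zero (γ : ℝ) (hγ : 0 < γ) (lamhat : ℝ)
    (hlim : Filter.Tendsto (fun d : ℕ => lamMinR (Mgd γ d)) Filter.atTop (nhds lamhat)) :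
    HasSum (fun k : ℕ =>
      (-1 : ℝ) ^ k / ((k.factorial : ℝ) * Real.Gamma ((k : ℝ) - lamhat / γ)) *
        (1 / γ) ^ (2 * (k : ℝ) - lamhat / γ - 1)) 0 := by
  have hneg : lamhat < 0 := by
    refine (le_of_tendsto hlim ?_).trans_lt (neg_neg_of_pos (by positivity : 0 < 1 / (γ + 1)))
    filter_upwards [Filter.eventually_ge_atTop 2] with d hd
    exact lamMinR_Mgd_le hγ hd
  have hν₀ : 0 < -lamhat / γ := div_pos (neg_pos.mpr hneg) hγ
  have hmain := hasSum_bessel_of_tendsto_lommelPoly_zero hν₀ (hlim.neg.div_const γ)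
    (s := (1 / γ) ^ 2) (by
      filter_upwards [Filter.eventually_ge_atTop 1] with d hd
      have : Nonempty (Fin d) := ⟨⟨0, hd⟩⟩
      exact lommelPoly_eq_zero_of_mem_spectrum hγ (isLeast_lamMinR (Mgd_isHermitian γ d)).1)
  have hscaled := hmain.mul_left ((1 / γ) ^ (-lamhat / γ - 1) / Real.Gamma (-lamhat / γ))
  rw [mul_zero] at hscaled
  refine hscaled.congr_fun fun k => ?_
  have hG := Real.Gamma_pos_of_pos hν₀
  have hp := prod_add_natCast_pos hν₀ (Finset.range k)
  rw [show (k : ℝ) - lamhat / γ = k + -lamhat / γ by ring, Gamma_natCast_add hν₀,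
    show 2 * (k : ℝ) - lamhat / γ - 1 = (-lamhat / γ - 1) + (2 * k : ℕ) by push_cast; ring,
    Real.rpow_add_natCast (by positivity), pow_mul,
    neg_pow ((1 / γ) ^ 2)]
  field_simp
end
end
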